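/- arXiv:2204.04772 — 8 statements merged into one kernel-verified Lean document; each statement's English description precedes it below -/
import Mathlib

section
/- Let F = X1·X2·X3 − X1·X2·X4 − X1·X3·X4 + X1·X4·X5 + X2·X3·X4 − X2·X3·X5, a cubic form in C[X1,…,X5]. For a nonzero vector v ∈ C^5, all five partial derivatives ∂F/∂Xi vanish at v if and only if v is a nonzero scalar multiple of one of the following ten vectors: the five standard basis vectors e1,…,e5 of C^5, together with (1,1,1,1,1), (0,0,1,1,1), (0,1,0,1,1), (1,1,0,0,1) and (1,0,1,0,1). Hence the Segre cubic hypersurface {F = 0} ⊂ P4 has exactly ten singular points. -/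
open MvPolynomial

/-- The cubic form `F = X1·X2·X3 − X1·X2·X4 − X1·X3·X4 + X1·X4·X5 + X2·X3·X4 − X2·X3·X5`
cutting out the Segre cubic hypersurface (indices shifted to `0,…,4`). -/
noncomputable def segreCubic : MvPolynomial (Fin 5) ℂ :=
  X 0 * X 1 * X 2 - X 0 * X 1 * X 3 - X 0 * X 2 * X 3
    + X 0 * X 3 * X 4 + X 1 * X 2 * X 3 - X 1 * X 2 * X 4

/-- The ten vectors whose projectivizations are the ten nodes of the Segre cubic:
the five standard basis vectors of `ℂ⁵` together with `(1,1,1,1,1)`, `(0,0,1,1,1)`,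
`(0,1,0,1,1)`, `(1,1,0,0,1)` and `(1,0,1,0,1)`. -/
def segreNodes : Set (Fin 5 → ℂ) :=
  { ![1,0,0,0,0], ![0,1,0,0,0], ![0,0,1,0,0], ![0,0,0,1,0], ![0,0,0,0,1],
    ![1,1,1,1,1], ![0,0,1,1,1], ![0,1,0,1,1], ![1,1,0,0,1], ![1,0,1,0,1] }

/-- The solutions of the system of partial derivatives, in coordinates. -/
theorem segre_solve (a b c d e : ℂ) (h0 : d * (a - b - c + e) = 0)
    (h1 : c * (a - b + d - e) = 0) (h2 : b * (a - c + d - e) = 0)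
    (h3 : a * (d - b - c + e) = 0) (h4 : a * d = b * c) :
    (b = 0 ∧ c = 0 ∧ d = 0 ∧ e = 0) ∨ (a = 0 ∧ c = 0 ∧ d = 0 ∧ e = 0) ∨
    (a = 0 ∧ b = 0 ∧ d = 0 ∧ e = 0) ∨ (a = 0 ∧ b = 0 ∧ c = 0 ∧ e = 0) ∨
    (a = 0 ∧ b = 0 ∧ c = 0 ∧ d = 0) ∨ (a = e ∧ b = e ∧ c = e ∧ d = e) ∨
    (a = 0 ∧ b = 0 ∧ c = e ∧ d = e) ∨ (a = 0 ∧ b = e ∧ c = 0 ∧ d = e) ∨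
    (a = e ∧ b = e ∧ c = 0 ∧ d = 0) ∨ (a = e ∧ b = 0 ∧ c = e ∧ d = 0) := by
  by_cases ha : a = 0 <;> by_cases hb : b = 0 <;> by_cases hc : c = 0 <;>
    by_cases hd : d = 0 <;> simp only [ha, hb, hc, hd, zero_mul, mul_zero, mul_eq_zero,
      false_or, zero_eq_mul, or_self] at h0 h1 h2 h3 h4 <;> grind

/-- for a nonzero vector `v ∈ ℂ⁵`, all five partial derivatives `∂F/∂Xi` of the
Segre cubic form vanish at `v` if and only if `v` is a nonzero scalar multiple of one of the
ten listed vectors.  Hence the Segre cubic hypersurface has exactly ten singular points. -/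
theorem stmt1 (v : Fin 5 → ℂ) (hv : v ≠ 0) :
    (∀ i : Fin 5, MvPolynomial.eval v (MvPolynomial.pderiv i segreCubic) = 0) ↔
      ∃ c : ℂ, c ≠ 0 ∧ ∃ w ∈ segreNodes, v = c • w := by
  have key : (∀ i : Fin 5, MvPolynomial.eval v (MvPolynomial.pderiv i segreCubic) = 0) ↔
      (v 3 * (v 0 - v 1 - v 2 + v 4) = 0 ∧ v 2 * (v 0 - v 1 + v 3 - v 4) = 0 ∧
        v 1 * (v 0 - v 2 + v 3 - v 4) = 0 ∧ v 0 * (v 3 - v 1 - v 2 + v 4) = 0 ∧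
        v 0 * v 3 = v 1 * v 2) := by
    simp [Fin.forall_fin_succ, segreCubic, pderiv_X, Pi.single_apply, Derivation.leibniz]
    grind
  rw [key]
  constructor
  · rintro ⟨h0, h1, h2, h3, h4⟩
    have hn : ¬ (v 0 = 0 ∧ v 1 = 0 ∧ v 2 = 0 ∧ v 3 = 0 ∧ v 4 = 0) := by
      rintro ⟨g0, g1, g2, g3, g4⟩
      apply hv
      ext i
      fin_cases i <;> simpa
    have build : ∀ (c : ℂ) (w : Fin 5 → ℂ), w ∈ segreNodes →
        v 0 = c * w 0 → v 1 = c * w 1 → v 2 = c * w 2 → v 3 = c * w 3 → v 4 = c * w 4 →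
        ∃ c : ℂ, c ≠ 0 ∧ ∃ w ∈ segreNodes, v = c • w := by
      intro c w hw g0 g1 g2 g3 g4
      refine ⟨c, ?_, w, hw, ?_⟩
      · rintro rfl
        apply hn
        simp [g0, g1, g2, g3, g4]
      · ext i
        fin_cases i <;> simpa
    rcases segre_solve _ _ _ _ _ h0 h1 h2 h3 h4 with h | h | h | h | h | h | h | h | h | h <;>
      obtain ⟨g1, g2, g3, g4⟩ := h
    · apply build (v 0) ![1,0,0,0,0] <;> simp [segreNodes, *]
    · apply build (v 1) ![0,1,0,0,0] <;> simp [segreNodes, *]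
    · apply build (v 2) ![0,0,1,0,0] <;> simp [segreNodes, *]
    · apply build (v 3) ![0,0,0,1,0] <;> simp [segreNodes, *]
    · apply build (v 4) ![0,0,0,0,1] <;> simp [segreNodes, *]
    · apply build (v 4) ![1,1,1,1,1] <;> simp [segreNodes, *]
    · apply build (v 4) ![0,0,1,1,1] <;> simp [segreNodes, *]
    · apply build (v 4) ![0,1,0,1,1] <;> simp [segreNodes, *]
    · apply build (v 4) ![1,1,0,0,1] <;> simp [segreNodes, *]
    · apply build (v 4) ![1,0,1,0,1] <;> simp [segreNodes, *]
  · rintro ⟨c, -, w, hw, rfl⟩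
    simp only [segreNodes, Set.mem_insert_iff, Set.mem_singleton_iff] at hw
    rcases hw with rfl | rfl | rfl | rfl | rfl | rfl | rfl | rfl | rfl | rfl <;> simp
end

section
/- Let Ω ⊂ C^3 be the set of triples (x,y,z) with x, y, z each different from 0 and 1 and pairwise distinct. On Ω define the pairs of functions (u1,v1) = (y,z), (u2,v2) = (x,z), (u3,v3) = (x,y), (u4,v4) = (x/z, y/z), (u5,v5) = ((x−1)/(z−1), (y−1)/(z−1)), (u6,v6) = (x(z−1)/(z(x−1)), y(z−1)/(z(y−1))). Then at every point p ∈ Ω and for all vectors w1, w2 ∈ C^3 one has: (1/(v1(u1−1)(v1−1)))·J1 − (1/(u2(v2−1)(u2−v2)))·J2 + (1/(u3(v3−1)(u3−v3)))·J3 − (1/((u4−1)(u4−v4)))·J4 + (1/((u5−1)(u5−v5)))·J5 + (1/(u6(u6−v6)))·J6 = 0, where for each i, Ji = Dui(p)(w1)·Dvi(p)(w2) − Dui(p)(w2)·Dvi(p)(w1), Df(p)(w) denoting the directional (Fréchet) derivative of f at p in direction w, and all the displayed denominators are nonzero on Ω. (This is the 2-form identity Σ ±(dui∧dvi)/(denominator)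 = 0, an abelian relation of the 6-web W_{0,6}.) -/
/- The six rational first integrals `Uᵢ = (uᵢ, vᵢ)` of the web `W_{0,6}` in the affine
coordinates `(x, y, z)`, realized as functions on `ℂ × ℂ × ℂ` with `x = p.1`, `y = p.2.1`,
`z = p.2.2`. -/
noncomputable def u1 : ℂ × ℂ × ℂ → ℂ := fun p => p.2.1
noncomputable def v1 : ℂ × ℂ × ℂ → ℂ := fun p => p.2.2
noncomputable def u2 : ℂ × ℂ × ℂ → ℂ := fun p => p.1
noncomputable def v2 : ℂ × ℂ × ℂ → ℂ := fun p => p.2.2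
noncomputable def u3 : ℂ × ℂ × ℂ → ℂ := fun p => p.1
noncomputable def v3 : ℂ × ℂ × ℂ → ℂ := fun p => p.2.1
noncomputable def u4 : ℂ × ℂ × ℂ → ℂ := fun p => p.1 / p.2.2
noncomputable def v4 : ℂ × ℂ × ℂ → ℂ := fun p => p.2.1 / p.2.2
noncomputable def u5 : ℂ × ℂ × ℂ → ℂ := fun p => (p.1 - 1) / (p.2.2 - 1)
noncomputable def v5 : ℂ × ℂ × ℂ → ℂ := fun p => (p.2.1 - 1) / (p.2.2 - 1)
noncomputable def u6 : ℂ × ℂ × ℂ → ℂ := fun p => p.1 * (p.2.2 - 1) / (p.2.2 * (p.1 - 1))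
noncomputable def v6 : ℂ × ℂ × ℂ → ℂ := fun p => p.2.1 * (p.2.2 - 1) / (p.2.2 * (p.2.1 - 1))

/-- The evaluation of the 2-form `df ∧ dg` at `p` on the pair of vectors `(w1, w2)`:
`Df(p)(w1)·Dg(p)(w2) − Df(p)(w2)·Dg(p)(w1)`, where `Df(p)(w)` is the directional (Fréchet)
derivative of `f` at `p` in the direction `w`. -/
noncomputable def wedge (f g : ℂ × ℂ × ℂ → ℂ) (p w1 w2 : ℂ × ℂ × ℂ) : ℂ :=
  fderiv ℂ f p w1 * fderiv ℂ g p w2 - fderiv ℂ f p w2 * fderiv ℂ g p w1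

lemma aux_div {f g : ℂ × ℂ × ℂ → ℂ} {p : ℂ × ℂ × ℂ} (w : ℂ × ℂ × ℂ)
    (hf : DifferentiableAt ℂ f p) (hg : DifferentiableAt ℂ g p) (h : g p ≠ 0) :
    fderiv ℂ (fun q => f q / g q) p w
      = (fderiv ℂ f p w * g p - f p * fderiv ℂ g p w) / g p ^ 2 := by
  have hi : HasFDerivAt (fun q => (g q)⁻¹) (-((g p) ^ 2)⁻¹ • fderiv ℂ g p) p :=
    (hasDerivAt_inv h).comp_hasFDerivAt p hg.hasFDerivAt
  have hm := hf.hasFDerivAt.mul hi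
  have : fderiv ℂ (fun q => f q / g q) p
      = f p • -(g p ^ 2)⁻¹ • fderiv ℂ g p + (g p)⁻¹ • fderiv ℂ f p := by
    simp only [div_eq_mul_inv]
    exact hm.fderiv
  rw [this]
  simp
  field_simp
  ring

lemma aux_mul {f g : ℂ × ℂ × ℂ → ℂ} {p : ℂ × ℂ × ℂ} (w : ℂ × ℂ × ℂ)
    (hf : DifferentiableAt ℂ f p) (hg : DifferentiableAt ℂ g p) :
    fderiv ℂ (fun q => f q * g q) p w = fderiv ℂ f p w * g p + f p * fderiv ℂ g p w := by
  have : fderiv ℂ (fun q => f q * g q) p = _ := (hf.hasFDerivAt.mul hg.hasFDerivAt).fderiv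
  rw [this]
  simp
  ring

lemma aux_x (p w : ℂ × ℂ × ℂ) : fderiv ℂ (fun q : ℂ × ℂ × ℂ => q.1) p w = w.1 := by
  rw [fderiv_fst]; rfl

lemma aux_y (p w : ℂ × ℂ × ℂ) : fderiv ℂ (fun q : ℂ × ℂ × ℂ => q.2.1) p w = w.2.1 := by
  have h : HasFDerivAt (fun q : ℂ × ℂ × ℂ => q.2.1) _ p :=
    (hasFDerivAt_snd (𝕜 := ℂ) (p := p)).fst
  rw [h.fderiv]; rfl

lemma aux_z (p w : ℂ × ℂ × ℂ) : fderiv ℂ (fun q : ℂ × ℂ × ℂ => q.2.2) p w = w.2.2 := by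
  have h : HasFDerivAt (fun q : ℂ × ℂ × ℂ => q.2.2) _ p :=
    (hasFDerivAt_snd (𝕜 := ℂ) (p := p)).snd
  rw [h.fderiv]; rfl

lemma aux_six (a : ℂ × ℂ × ℂ → ℂ) (p w : ℂ × ℂ × ℂ) (ha : DifferentiableAt ℂ a p)
    (h1 : a p - 1 ≠ 0) (hz : p.2.2 ≠ 0) :
    fderiv ℂ (fun q : ℂ × ℂ × ℂ => a q * (q.2.2 - 1) / (q.2.2 * (a q - 1))) p w
      = (a p * (a p - 1) * w.2.2 - p.2.2 * (p.2.2 - 1) * fderiv ℂ a p w)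
        / (p.2.2 ^ 2 * (a p - 1) ^ 2) := by
  rw [aux_div w (by fun_prop) (by fun_prop) (mul_ne_zero hz h1),
    aux_mul w (by fun_prop) (by fun_prop), aux_mul w (by fun_prop) (by fun_prop),
    fderiv_sub_const, fderiv_sub_const, aux_z]
  field_simp
  ring

/-- the 2-form abelian relation
`Σᵢ ±(duᵢ∧dvᵢ)/(denominatorᵢ) = 0` of the web `W_{0,6}` (trace of the canonical 2-form on the
Fano surface of the Segre cubic corresponding to the Plücker coordinate `Δ_{4,5}`), together
with the nonvanishing of all displayed denominators on `Ω`. -/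
theorem stmt2 (p : ℂ × ℂ × ℂ)
    (hx0 : p.1 ≠ 0) (hx1 : p.1 ≠ 1) (hy0 : p.2.1 ≠ 0) (hy1 : p.2.1 ≠ 1)
    (hz0 : p.2.2 ≠ 0) (hz1 : p.2.2 ≠ 1)
    (hxy : p.1 ≠ p.2.1) (hxz : p.1 ≠ p.2.2) (hyz : p.2.1 ≠ p.2.2)
    (w1 w2 : ℂ × ℂ × ℂ) :
    v1 p * (u1 p - 1) * (v1 p - 1) ≠ 0 ∧
    u2 p * (v2 p - 1) * (u2 p - v2 p) ≠ 0 ∧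
    u3 p * (v3 p - 1) * (u3 p - v3 p) ≠ 0 ∧
    (u4 p - 1) * (u4 p - v4 p) ≠ 0 ∧
    (u5 p - 1) * (u5 p - v5 p) ≠ 0 ∧
    u6 p * (u6 p - v6 p) ≠ 0 ∧
    (1 / (v1 p * (u1 p - 1) * (v1 p - 1))) * wedge u1 v1 p w1 w2
      - (1 / (u2 p * (v2 p - 1) * (u2 p - v2 p))) * wedge u2 v2 p w1 w2
      + (1 / (u3 p * (v3 p - 1) * (u3 p - v3 p))) * wedge u3 v3 p w1 w2
      - (1 / ((u4 p - 1) * (u4 p - v4 p))) * wedge u4 v4 p w1 w2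
      + (1 / ((u5 p - 1) * (u5 p - v5 p))) * wedge u5 v5 p w1 w2
      + (1 / (u6 p * (u6 p - v6 p))) * wedge u6 v6 p w1 w2 = 0 := by
  have X1 := sub_ne_zero.2 hx1
  have Y1 := sub_ne_zero.2 hy1
  have Z1 := sub_ne_zero.2 hz1
  have XY := sub_ne_zero.2 hxy
  have XZ := sub_ne_zero.2 hxz
  have e41 : u4 p - 1 = (p.1 - p.2.2) / p.2.2 := by
    simp only [u4]; field_simp
  have e4 : u4 p - v4 p = (p.1 - p.2.1) / p.2.2 := by
    simp only [u4, v4]; field_simp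
  have e51 : u5 p - 1 = (p.1 - p.2.2) / (p.2.2 - 1) := by
    simp only [u5]; field_simp; ring
  have e5 : u5 p - v5 p = (p.1 - p.2.1) / (p.2.2 - 1) := by
    simp only [u5, v5]; field_simp; ring
  have e6 : u6 p - v6 p
      = -((p.1 - p.2.1) * (p.2.2 - 1)) / (p.2.2 * (p.1 - 1) * (p.2.1 - 1)) := by
    simp only [u6, v6]; field_simp; ring
  have e60 : u6 p = p.1 * (p.2.2 - 1) / (p.2.2 * (p.1 - 1)) := rfl
  have d4 : ∀ w, fderiv ℂ u4 p w = (w.1 * p.2.2 - p.1 * w.2.2) / p.2.2 ^ 2 := fun w => by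
    unfold u4; rw [aux_div w (by fun_prop) (by fun_prop) hz0, aux_x, aux_z]
  have d4v : ∀ w, fderiv ℂ v4 p w = (w.2.1 * p.2.2 - p.2.1 * w.2.2) / p.2.2 ^ 2 := fun w => by
    unfold v4; rw [aux_div w (by fun_prop) (by fun_prop) hz0, aux_y, aux_z]
  have d5 : ∀ w, fderiv ℂ u5 p w
      = (w.1 * (p.2.2 - 1) - (p.1 - 1) * w.2.2) / (p.2.2 - 1) ^ 2 := fun w => by
    unfold u5
    rw [aux_div w (by fun_prop) (by fun_prop) Z1, fderiv_sub_const, fderiv_sub_const,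
      aux_x, aux_z]
  have d5v : ∀ w, fderiv ℂ v5 p w
      = (w.2.1 * (p.2.2 - 1) - (p.2.1 - 1) * w.2.2) / (p.2.2 - 1) ^ 2 := fun w => by
    unfold v5
    rw [aux_div w (by fun_prop) (by fun_prop) Z1, fderiv_sub_const, fderiv_sub_const,
      aux_y, aux_z]
  have d6 : ∀ w, fderiv ℂ u6 p w = (p.1 * (p.1 - 1) * w.2.2 - p.2.2 * (p.2.2 - 1) * w.1)
        / (p.2.2 ^ 2 * (p.1 - 1) ^ 2) := fun w => by
    unfold u6
    rw [aux_six (fun q => q.1) p w (by fun_prop) X1 hz0, aux_x]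
  have d6v : ∀ w, fderiv ℂ v6 p w = (p.2.1 * (p.2.1 - 1) * w.2.2 - p.2.2 * (p.2.2 - 1) * w.2.1)
        / (p.2.2 ^ 2 * (p.2.1 - 1) ^ 2) := fun w => by
    unfold v6
    rw [aux_six (fun q => q.2.1) p w (by fun_prop) Y1 hz0, aux_y]
  refine ⟨mul_ne_zero (mul_ne_zero hz0 Y1) Z1, mul_ne_zero (mul_ne_zero hx0 Z1) XZ,
    mul_ne_zero (mul_ne_zero hx0 Y1) XY, ?_, ?_, ?_, ?_⟩
  · rw [e41, e4]
    exact mul_ne_zero (div_ne_zero XZ hz0) (div_ne_zero XY hz0)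
  · rw [e51, e5]
    exact mul_ne_zero (div_ne_zero XZ Z1) (div_ne_zero XY Z1)
  · rw [e6, e60]
    exact mul_ne_zero (div_ne_zero (mul_ne_zero hx0 Z1) (mul_ne_zero hz0 X1))
      (div_ne_zero (neg_ne_zero.2 (mul_ne_zero XY Z1)) (mul_ne_zero (mul_ne_zero hz0 X1) Y1))
  · have d1 : ∀ w, fderiv ℂ u1 p w = w.2.1 := aux_y p
    have d1v : ∀ w, fderiv ℂ v1 p w = w.2.2 := aux_z p
    have d2 : ∀ w, fderiv ℂ u2 p w = w.1 := aux_x p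
    have d2v : ∀ w, fderiv ℂ v2 p w = w.2.2 := aux_z p
    have d3 : ∀ w, fderiv ℂ u3 p w = w.1 := aux_x p
    have d3v : ∀ w, fderiv ℂ v3 p w = w.2.1 := aux_y p
    rw [e41, e4, e51, e5, e6, e60]
    simp only [wedge, d1, d1v, d2, d2v, d3, d3v, d4, d4v, d5, d5v, d6, d6v]
    simp only [u1, v1, u2, v2, u3, v3]
    clear d1 d1v d2 d2v d3 d3v d4 d4v d5 d5v d6 d6v e41 e4 e51 e5 e6 e60
    obtain ⟨x, y, z⟩ := p
    obtain ⟨a, b, c⟩ := w1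
    obtain ⟨a2, b2, c2⟩ := w2
    simp only at *
    field_simp
    ring
end

section
/- Let s, t1, t2 be complex numbers with s ∉ {0, i, −i}, t1 ≠ t2, s·t2 + i·t1 ≠ 0 and s·t2 − i·t1 ≠ 0. Set a+ = (s·t2 + i·t1)/(s + i), b+ = (s·t2² + i·t1²)/(s·t2 + i·t1), a− = (s·t2 − i·t1)/(s − i), b− = (s·t2² − i·t1²)/(s·t2 − i·t1). Then a+ ≠ b+, a− ≠ b−, a+ ≠ 0, a− ≠ 0, and the following four identities hold: (1) 1/(a+ − b+) + 1/(a− − b−) + 2(t1 + t2)/(t1 − t2)² = 0; (2) 1/(a+·(a+ − b+)) + 1/(a−·(a− − b−)) + 4/(t1 − t2)² = 0; (3) a+·b+/(a+ − b+) + a−·b−/(a− − b−) + 2·t1·t2·(t1 + t2)/(t1 − t2)² = 0; (4) a+·b+²/(a+ − b+) + a−·b−²/(a− − b−) + 4·t1²·t2²/(t1 − t2)² = 0. -/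
open Complex

/-- the four abelian relations of the 3-web of lines on the chordal cubic,
in the coordinates given by the first integrals `U″₊ = (a₊, b₊)`, `U″₋ = (a₋, b₋)`,
`U′ = (t1, t2)`. -/
theorem stmt4 (s t1 t2 : ℂ) (hs0 : s ≠ 0) (hsI : s ≠ Complex.I) (hsI' : s ≠ -Complex.I)
    (ht : t1 ≠ t2) (hp : s * t2 + Complex.I * t1 ≠ 0) (hm : s * t2 - Complex.I * t1 ≠ 0) :
    let ap := (s * t2 + Complex.I * t1) / (s + Complex.I)
    let bp := (s * t2 ^ 2 + Complex.I * t1 ^ 2) / (s * t2 + Complex.I * t1)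
    let am := (s * t2 - Complex.I * t1) / (s - Complex.I)
    let bm := (s * t2 ^ 2 - Complex.I * t1 ^ 2) / (s * t2 - Complex.I * t1)
    ap ≠ bp ∧ am ≠ bm ∧ ap ≠ 0 ∧ am ≠ 0 ∧
    1 / (ap - bp) + 1 / (am - bm) + 2 * (t1 + t2) / (t1 - t2) ^ 2 = 0 ∧
    1 / (ap * (ap - bp)) + 1 / (am * (am - bm)) + 4 / (t1 - t2) ^ 2 = 0 ∧
    ap * bp / (ap - bp) + am * bm / (am - bm)
      + 2 * t1 * t2 * (t1 + t2) / (t1 - t2) ^ 2 = 0 ∧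
    ap * bp ^ 2 / (ap - bp) + am * bm ^ 2 / (am - bm)
      + 4 * t1 ^ 2 * t2 ^ 2 / (t1 - t2) ^ 2 = 0 := by
  intro ap bp am bm
  have hI : Complex.I ≠ 0 := Complex.I_ne_zero
  have h1 : s + Complex.I ≠ 0 := fun h => hsI' (eq_neg_of_add_eq_zero_left h)
  have h2 : s - Complex.I ≠ 0 := sub_ne_zero.mpr hsI
  have hd : t1 - t2 ≠ 0 := sub_ne_zero.mpr ht
  have ep : ap - bp = -(s * Complex.I * (t1 - t2) ^ 2)
      / ((s + Complex.I) * (s * t2 + Complex.I * t1)) := by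
    simp only [ap, bp]
    rw [div_sub_div _ _ h1 hp]
    congr 1
    ring
  have em : am - bm = (s * Complex.I * (t1 - t2) ^ 2)
      / ((s - Complex.I) * (s * t2 - Complex.I * t1)) := by
    simp only [am, bm]
    rw [div_sub_div _ _ h2 hm]
    congr 1
    ring
  have np : ap - bp ≠ 0 := by
    rw [ep]
    exact div_ne_zero (neg_ne_zero.mpr (mul_ne_zero (mul_ne_zero hs0 hI) (pow_ne_zero 2 hd)))
      (mul_ne_zero h1 hp)
  have nm : am - bm ≠ 0 := by
    rw [em]
    exact div_ne_zero (mul_ne_zero (mul_ne_zero hs0 hI) (pow_ne_zero 2 hd))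
      (mul_ne_zero h2 hm)
  refine ⟨sub_ne_zero.mp np, sub_ne_zero.mp nm, div_ne_zero hp h1, div_ne_zero hm h2,
    ?_, ?_, ?_, ?_⟩
  all_goals
    rw [ep, em]
    try simp only [ap, bp, am, bm]
    clear_value ap bp am bm
    clear ep em np nm
    generalize Complex.I = J at *
    field_simp
    ring
end

section
/- For every real number u > 1, the integral over (k1, k2, h) ∈ (0,∞)³, with respect to Lebesgue measure, of the function ((1 + k1 + h·u²)(1 + k2 + h) − (1 + h·u)²)^(−2) equals 2·(log(u)/(u−1) − log(u−1)/u). (The base (1 + k1 + h·u²)(1 + k2 + h) − (1 + h·u)² is positive on the domain of integration, being the Gram determinant of two linearly independent vectors.) -/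
open MeasureTheory

open Filter Topology in
lemma aux_lint (g g' : ℝ → ℝ) (m : ℝ) (hc : ContinuousWithinAt g (Set.Ici 0) 0)
    (hd : ∀ x ∈ Set.Ioi (0:ℝ), HasDerivAt g (g' x) x)
    (hn : ∀ x ∈ Set.Ioi (0:ℝ), 0 ≤ g' x) (hm : Tendsto g atTop (𝓝 m)) :
    ∫⁻ x in Set.Ioi (0:ℝ), ENNReal.ofReal (g' x) = ENNReal.ofReal (m - g 0) := by
  rw [← integral_Ioi_of_hasDerivAt_of_nonneg hc hd hn hm,
    ofReal_integral_eq_lintegral_ofReal]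
  · exact integrableOn_Ioi_deriv_of_nonneg hc hd hn hm
  · exact (ae_restrict_iff' measurableSet_Ioi).2 (Eventually.of_forall hn)

open Filter Topology in
lemma aux_k1 (a t c : ℝ) (ht : 0 < t) (h : 0 < a * t - c) :
    ∫⁻ x in Set.Ioi (0:ℝ), ENNReal.ofReal (((a + x) * t - c) ^ (-2 : ℤ))
      = ENNReal.ofReal (1 / (t * (a * t - c))) := by
  have hp : ∀ x : ℝ, 0 ≤ x → 0 < (a + x) * t - c := fun x hx => by
    nlinarith [mul_nonneg hx ht.le]
  have hd : ∀ x : ℝ, 0 ≤ x → HasDerivAt (fun x => -(1 / (t * ((a + x) * t - c))))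
      (((a + x) * t - c) ^ (-2 : ℤ)) x := fun x hx => by
    have h1 : HasDerivAt (fun x : ℝ => t * ((a + x) * t - c)) (t * (1 * t)) x :=
      ((((hasDerivAt_id x).const_add a).mul_const t).sub_const c).const_mul t
    have h2 := (h1.inv (mul_pos ht (hp x hx)).ne').neg
    have := hp x hx
    simp only [one_div]
    refine h2.congr_deriv ?_
    rw [zpow_neg]
    simp only [zpow_ofNat]
    field_simp
  rw [aux_lint (fun x => -(1 / (t * ((a + x) * t - c)))) _ 0
    (hd 0 le_rfl).continuousAt.continuousWithinAt (fun x hx => hd x (le_of_lt hx))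
    (fun x hx => zpow_nonneg (hp x (le_of_lt hx)).le _)]
  · simp
  · have h1 : Tendsto (fun x : ℝ => t * ((a + x) * t - c)) atTop atTop := by
      apply Tendsto.const_mul_atTop ht
      exact tendsto_atTop_add_const_right _ _
        ((tendsto_atTop_add_const_left _ _ tendsto_id).atTop_mul_const ht)
    simpa using h1.inv_tendsto_atTop.neg

open Filter Topology in
lemma aux_k2 (a b c : ℝ) (ha : 0 < a) (hb : 0 < b) (hcp : 0 < c) (h : 0 < a * b - c) :
    ∫⁻ x in Set.Ioi (0:ℝ), ENNReal.ofReal (1 / ((b + x) * (a * (b + x) - c)))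
      = ENNReal.ofReal ((Real.log a + Real.log b - Real.log (a * b - c)) / c) := by
  have hp : ∀ x : ℝ, 0 ≤ x → 0 < a * (b + x) - c := fun x hx => by
    nlinarith [mul_nonneg ha.le hx]
  have hq : ∀ x : ℝ, 0 ≤ x → 0 < b + x := fun x hx => by linarith
  have hd : ∀ x : ℝ, 0 ≤ x → HasDerivAt
      (fun x => (Real.log (a * (b + x) - c) - Real.log (b + x)) / c)
      (1 / ((b + x) * (a * (b + x) - c))) x := fun x hx => by
    have h0 : HasDerivAt (fun x : ℝ => b + x) 1 x := (hasDerivAt_id x).const_add b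
    have h1 := ((h0.const_mul a).sub_const c).log (hp x hx).ne'
    have h2 := (h1.sub (h0.log (hq x hx).ne')).div_const c
    have := hp x hx
    have := hq x hx
    refine h2.congr_deriv ?_
    field_simp
    ring
  rw [aux_lint (fun x => (Real.log (a * (b + x) - c) - Real.log (b + x)) / c) _
    (Real.log a / c)
    (hd 0 le_rfl).continuousAt.continuousWithinAt (fun x hx => hd x (le_of_lt hx))
    (fun x hx => by
      have := hp x (le_of_lt hx)
      have := hq x (le_of_lt hx)
      positivity)]
  · congr 1
    simp only [add_zero]
    ring
  · have h1 : Tendsto (fun x : ℝ => a - c * (b + x)⁻¹) atTop (𝓝 (a - c * 0)) :=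
      tendsto_const_nhds.sub (tendsto_const_nhds.mul
        (tendsto_atTop_add_const_left _ _ tendsto_id).inv_tendsto_atTop)
    rw [mul_zero, sub_zero] at h1
    refine ((h1.log ha.ne').div_const c).congr' ?_
    filter_upwards [eventually_ge_atTop 0] with x hx
    have := hp x hx
    have := hq x hx
    rw [← Real.log_div (by positivity) (by positivity)]
    congr 2
    field_simp

open Filter Topology in
lemma aux_h (u : ℝ) (hu : 1 < u) :
    ∫⁻ x in Set.Ioi (0:ℝ), ENNReal.ofReal ((Real.log (1 + x * u ^ 2) + Real.log (1 + x)
        - Real.log ((1 + x * u ^ 2) * (1 + x) - (1 + x * u) ^ 2)) / (1 + x * u) ^ 2)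
      = ENNReal.ofReal (2 * (Real.log u / (u - 1) - Real.log (u - 1) / u)) := by
  have hu1 : 0 < u - 1 := by linarith
  have hu0 : 0 < u := by linarith
  set G : ℝ → ℝ := fun x => (x * (Real.log (1 + x * u ^ 2) + Real.log (1 + x)
      - 2 * Real.log (u - 1)) - x * Real.log x) / (1 + x * u)
      + Real.log (1 + x * u ^ 2) / (u * (u - 1)) - Real.log (1 + x) / (u - 1) with hG
  have e : ∀ x : ℝ, (1 + x * u ^ 2) * (1 + x) - (1 + x * u) ^ 2 = x * (u - 1) ^ 2 :=
    fun x => by ring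
  rw [aux_lint G _ (2 * (Real.log u / (u - 1) - Real.log (u - 1) / u))]
  · simp [hG]
  · apply ContinuousAt.continuousWithinAt
    have h1 : ContinuousAt (fun x : ℝ => Real.log (1 + x * u ^ 2)) 0 :=
      ContinuousAt.log (by fun_prop) (by simp)
    have h2 : ContinuousAt (fun x : ℝ => Real.log (1 + x)) 0 :=
      ContinuousAt.log (by fun_prop) (by simp)
    have h3 : ContinuousAt (fun x : ℝ => x * Real.log x) 0 :=
      Real.continuous_mul_log.continuousAt
    exact (((((continuousAt_id.mul ((h1.add h2).sub continuousAt_const)).sub h3).div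
      (by fun_prop) (by simp)).add (h1.div_const _)).sub (h2.div_const _))
  · intro x hx
    have hx : 0 < x := hx
    have p1 : 0 < 1 + x * u ^ 2 := by positivity
    have p2 : 0 < 1 + x := by positivity
    have p3 : 0 < 1 + x * u := by positivity
    have i := hasDerivAt_id x
    have h1 := ((i.mul_const (u ^ 2)).const_add 1).log p1.ne'
    have h2 := (i.const_add 1).log p2.ne'
    have h3 := i.log hx.ne'
    have h4 := (i.mul_const u).const_add 1
    have h5 := ((((i.mul ((h1.add h2).sub_const (2 * Real.log (u - 1)))).sub (i.mul h3)).div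
      h4 p3.ne').add (h1.div_const (u * (u - 1)))).sub (h2.div_const (u - 1))
    refine h5.congr_deriv ?_
    rw [e, Real.log_mul hx.ne' (by positivity), Real.log_pow]
    simp only [id, Pi.add_apply, Pi.sub_apply, Pi.mul_apply]
    push_cast
    generalize Real.log (1 + x * u ^ 2) = A
    generalize Real.log (1 + x) = B
    generalize Real.log (u - 1) = C
    generalize Real.log x = D
    have := hu1.ne'
    field_simp
    ring
  · intro x hx
    have hx : 0 < x := hx
    have p1 : 0 < 1 + x * u ^ 2 := by positivity
    have p2 : 0 < 1 + x := by positivity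
    apply div_nonneg _ (sq_nonneg _)
    rw [← Real.log_mul p1.ne' p2.ne', sub_nonneg]
    apply Real.log_le_log
    · rw [e]; positivity
    · nlinarith [sq_nonneg (1 + x * u)]
  · have hi : Tendsto (fun x : ℝ => x⁻¹) atTop (𝓝 0) := tendsto_inv_atTop_zero
    have hA : Tendsto (fun x : ℝ => Real.log (u ^ 2 + x⁻¹)) atTop (𝓝 (Real.log (u ^ 2 + 0))) :=
      (tendsto_const_nhds.add hi).log (by positivity)
    have hB : Tendsto (fun x : ℝ => Real.log (1 + x⁻¹)) atTop (𝓝 (Real.log (1 + 0))) :=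
      (tendsto_const_nhds.add hi).log (by simp)
    have hC : Tendsto (fun x : ℝ => (u + x⁻¹)⁻¹) atTop (𝓝 ((u + 0)⁻¹)) :=
      (tendsto_const_nhds.add hi).inv₀ (by positivity)
    have hD : Tendsto (fun x : ℝ => Real.log x / x) atTop (𝓝 0) :=
      Real.isLittleO_log_id_atTop.tendsto_div_nhds_zero
    have key := (((hC.mul ((hA.add hB).sub_const (2 * Real.log (u - 1)))).sub
      ((hD.mul hC).div_const u)).add (hA.div_const (u * (u - 1)))).sub (hB.div_const (u - 1))
    have ev : 2 * (Real.log u / (u - 1) - Real.log (u - 1) / u) =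
      (u + 0)⁻¹ * (Real.log (u ^ 2 + 0) + Real.log (1 + 0) - 2 * Real.log (u - 1))
      - 0 * (u + 0)⁻¹ / u + Real.log (u ^ 2 + 0) / (u * (u - 1)) - Real.log (1 + 0) / (u - 1) := by
      simp only [add_zero, Real.log_one, Real.log_pow]
      push_cast
      have := hu1.ne'
      field_simp
      ring
    rw [ev]
    refine key.congr' ?_
    filter_upwards [eventually_gt_atTop 0] with x hx
    have e1 : Real.log (1 + x * u ^ 2) = Real.log x + Real.log (u ^ 2 + x⁻¹) := by
      rw [← Real.log_mul hx.ne' (by positivity)]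
      congr 1
      field_simp
      ring
    have e2 : Real.log (1 + x) = Real.log x + Real.log (1 + x⁻¹) := by
      rw [← Real.log_mul hx.ne' (by positivity)]
      congr 1
      field_simp
      ring
    have e3 : (u + x⁻¹)⁻¹ = x / (1 + x * u) := by
      field_simp
      ring
    simp only [hG]
    rw [e1, e2, e3]
    generalize Real.log (u ^ 2 + x⁻¹) = A
    generalize Real.log (1 + x⁻¹) = B
    generalize Real.log (u - 1) = C
    generalize Real.log x = D
    have := hu1.ne'
    have p3 : 0 < 1 + x * u := by positivity
    field_simp
    ring

/-- for real `u > 1`, the integral over `(k1,k2,h) ∈ (0,∞)³` of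
`((1 + k1 + h·u²)(1 + k2 + h) − (1 + h·u)²)^(−2)` equals
`2·(log u/(u−1) − log(u−1)/u)`  (closed-form evaluation of `e₁`, whose antiderivative is
Rogers' dilogarithm). -/
theorem stmt5 (u : ℝ) (hu : 1 < u) :
    (∫ p in (Set.Ioi (0:ℝ) ×ˢ (Set.Ioi (0:ℝ) ×ˢ Set.Ioi (0:ℝ))),
        ((1 + p.1 + p.2.2 * u ^ 2) * (1 + p.2.1 + p.2.2) - (1 + p.2.2 * u) ^ 2) ^ (-2 : ℤ))
      = 2 * (Real.log u / (u - 1) - Real.log (u - 1) / u) := by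
  have hu1 : 0 < u - 1 := by linarith
  have hu0 : 0 < u := by linarith
  have hmeas : Measurable (fun p : ℝ × ℝ × ℝ =>
      ((1 + p.1 + p.2.2 * u ^ 2) * (1 + p.2.1 + p.2.2) - (1 + p.2.2 * u) ^ 2) ^ (-2 : ℤ)) := by
    simp only [zpow_neg, zpow_ofNat]
    fun_prop
  have hnn : 0 ≤ 2 * (Real.log u / (u - 1) - Real.log (u - 1) / u) := by
    have h1 : Real.log (u - 1) ≤ Real.log u := Real.log_le_log hu1 (by linarith)
    have h2 : 0 ≤ Real.log u := Real.log_nonneg hu.le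
    have h3 : Real.log (u - 1) / u ≤ Real.log u / u := by gcongr
    have h4 : Real.log u / u ≤ Real.log u / (u - 1) := by
      gcongr
      linarith
    linarith
  rw [integral_eq_lintegral_of_nonneg_ae
    (Filter.Eventually.of_forall fun p => Even.zpow_nonneg (by decide) _)
    hmeas.aestronglyMeasurable]
  rw [← ENNReal.toReal_ofReal hnn, ← aux_h u hu]
  congr 1
  rw [Measure.volume_eq_prod, ← Measure.prod_restrict, lintegral_prod_symm' _ hmeas.ennreal_ofReal,
    Measure.volume_eq_prod, ← Measure.prod_restrict,
    lintegral_prod_symm' _ hmeas.ennreal_ofReal.lintegral_prod_left']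
  refine setLIntegral_congr_fun measurableSet_Ioi fun h hh => ?_
  have hh : 0 < h := hh
  have hD : 0 < (1 + h * u ^ 2) * (1 + h) - (1 + h * u) ^ 2 := by
    have : (1 + h * u ^ 2) * (1 + h) - (1 + h * u) ^ 2 = h * (u - 1) ^ 2 := by ring
    rw [this]; positivity
  rw [← aux_k2 (1 + h * u ^ 2) (1 + h) ((1 + h * u) ^ 2) (by positivity) (by positivity)
    (by positivity) hD]
  refine setLIntegral_congr_fun measurableSet_Ioi fun k hk => ?_
  have hk : 0 < k := hk
  rw [← aux_k1 (1 + h * u ^ 2) (1 + h + k) ((1 + h * u) ^ 2) (by positivity) (by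
    have : 0 < (1 + h * u ^ 2) * k := by positivity
    nlinarith)]
  refine setLIntegral_congr_fun measurableSet_Ioi fun x _ => ?_
  simp only
  congr 2
  ring
end

section
/- For all real numbers u1, u2 with 1 < u1 < u2, the integral over (h2, h3, h4, h5) ∈ (0,∞)⁴, with respect to Lebesgue measure, of B(u,h)^(−5/2) equals (2π/3)/(u1·u2·(u2 − 1)), where B(u,h) = (β11·u1² − 2·h4·h5·u1·u2 + β22·u2²) − 2·h3·(h4·u1 + h5·u2) + β0, with β11 = h4·(h2 + h3 + h5), β22 = h5·(h2 + h3 + h4) and β0 = (1 + h3)·(1 + h2 + h4 + h5) − 1. (Equivalently B(u,h) = (1 + h3 + h4·u1² + h5·u2²)(h2 + h3 + h4 + h5) − (h3 + h4·u1 + h5·u2)², which is positive on the domain of integration.) -/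
open MeasureTheory
open Filter Topology Set

lemma lint_Ioi {F f : ℝ → ℝ} {l : ℝ} (hd : ∀ x ∈ Ici (0:ℝ), HasDerivAt F (f x) x)
    (hf : ∀ x ∈ Ioi (0:ℝ), 0 ≤ f x) (hl : Tendsto F atTop (𝓝 l)) :
    ∫⁻ x in Ioi (0:ℝ), ENNReal.ofReal (f x) = ENNReal.ofReal (l - F 0) := by
  rw [← ofReal_integral_eq_lintegral_ofReal (integrableOn_Ioi_deriv_of_nonneg' hd hf hl),
    integral_Ioi_of_hasDerivAt_of_nonneg' hd hf hl]
  exact (ae_restrict_iff' measurableSet_Ioi).2 (Eventually.of_forall hf)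

lemma integrable_line {F f : ℝ → ℝ} {l m : ℝ} (hd : ∀ x, HasDerivAt F (f x) x)
    (hf : ∀ x, 0 ≤ f x) (hl : Tendsto F atTop (𝓝 l)) (hm : Tendsto F atBot (𝓝 m)) :
    Integrable f := by
  have h1 : IntegrableOn f (Ioi 0) :=
    integrableOn_Ioi_deriv_of_nonneg' (fun x _ => hd x) (fun x _ => hf x) hl
  have h2 : IntegrableOn (fun x => f (-x)) (Ioi 0) := by
    refine integrableOn_Ioi_deriv_of_nonneg' (g := fun x => - F (-x)) (l := -m)
      (fun x _ => ?_) (fun x _ => hf _) ?_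
    · have := ((hd (-x)).comp x (hasDerivAt_neg x)).neg
      simp only [mul_neg, mul_one, neg_neg] at this
      exact this
    · exact (hm.comp tendsto_neg_atTop_atBot).neg
  have h3 : IntegrableOn f (Iic 0) := by
    rw [← integrableOn_Ici_iff_integrableOn_Ioi] at h2
    have := (Measure.measurePreserving_neg (volume : Measure ℝ)).integrableOn_comp_preimage
      (Homeomorph.neg ℝ).measurableEmbedding (f := f) (s := Iic 0)
    rw [← this]
    simpa [Function.comp_def] using h2
  rw [← integrableOn_univ, ← Set.Iic_union_Ioi (a := (0:ℝ))]
  exact h3.union h1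

lemma absTop : Tendsto (fun x : ℝ => |x|) atTop atTop := tendsto_abs_atTop_atTop
lemma absBot : Tendsto (fun x : ℝ => |x|) atBot atTop := tendsto_abs_atBot_atTop

lemma lim_inv {l : Filter ℝ} (hl : Tendsto (fun x : ℝ => |x|) l atTop) {p q : ℝ} (hp : 0 < p)
    (hq : 0 < q) : Tendsto (fun x : ℝ => 1 / (q + p * x ^ 2)) l (𝓝 0) := by
  have h : Tendsto (fun x : ℝ => q + p * |x| ^ 2) l atTop :=
    tendsto_atTop_add_const_left _ _
      (((tendsto_pow_atTop (two_ne_zero)).comp hl).const_mul_atTop hp)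
  have h2 := h.inv_tendsto_atTop
  simp only [sq_abs] at h2
  simp only [one_div]
  exact h2

lemma lim_div {l : Filter ℝ} (hl : Tendsto (fun x : ℝ => |x|) l atTop) {p q : ℝ} (hp : 0 < p)
    (hq : 0 < q) : Tendsto (fun x : ℝ => x / (q + p * x ^ 2)) l (𝓝 0) := by
  have h : Tendsto (fun x : ℝ => p⁻¹ * |x|⁻¹) l (𝓝 0) := by
    simpa using (hl.inv_tendsto_atTop).const_mul p⁻¹
  refine squeeze_zero_norm' ?_ h
  filter_upwards [hl.eventually_gt_atTop 0] with x hx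
  have : 0 < q + p * x ^ 2 := by positivity
  rw [Real.norm_eq_abs, abs_div, abs_of_pos this, ← mul_inv, div_le_iff₀ this, ← sq_abs x,
    inv_mul_eq_div, le_div_iff₀ (by positivity)]
  nlinarith

lemma arctan_top {p c : ℝ} (hp : 0 < p) :
    Tendsto (fun x : ℝ => Real.arctan (p * (x - c))) atTop (𝓝 (Real.pi / 2)) :=
  (tendsto_nhds_of_tendsto_nhdsWithin Real.tendsto_arctan_atTop).comp
    ((tendsto_atTop_add_const_right atTop (-c) tendsto_id).const_mul_atTop hp)

lemma arctan_bot {p c : ℝ} (hp : 0 < p) :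
    Tendsto (fun x : ℝ => Real.arctan (p * (x - c))) atBot (𝓝 (-(Real.pi / 2))) :=
  (tendsto_nhds_of_tendsto_nhdsWithin Real.tendsto_arctan_atBot).comp
    ((tendsto_atBot_add_const_right atBot (-c) tendsto_id).const_mul_atBot hp)

lemma shiftTop (c : ℝ) : Tendsto (fun x : ℝ => x - c) atTop atTop :=
  tendsto_atTop_add_const_right atTop (-c) tendsto_id
lemma shiftBot (c : ℝ) : Tendsto (fun x : ℝ => x - c) atBot atBot :=
  tendsto_atBot_add_const_right atBot (-c) tendsto_id

/-- the cubic one -/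
lemma lint_cubic {p q m : ℝ} (hp : 0 < p) (hq : 0 < q) :
    ∫⁻ x : ℝ, ENNReal.ofReal (1 / (q ^ 2 + p ^ 2 * (x - m) ^ 2) ^ 3)
      = ENNReal.ofReal (3 * Real.pi / (8 * p * q ^ 5)) := by
  let F : ℝ → ℝ := fun x => 1 / (4 * q ^ 2) *
      ((x - m) / (q ^ 2 + p ^ 2 * (x - m) ^ 2) * (1 / (q ^ 2 + p ^ 2 * (x - m) ^ 2)))
    + 3 / (8 * q ^ 4) * ((x - m) / (q ^ 2 + p ^ 2 * (x - m) ^ 2))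
    + 3 / (8 * q ^ 5 * p) * Real.arctan (p / q * (x - m))
  have hd : ∀ x, HasDerivAt F (1 / (q ^ 2 + p ^ 2 * (x - m) ^ 2) ^ 3) x := by
    intro x
    have hv : q ^ 2 + p ^ 2 * (x - m) ^ 2 ≠ 0 := by positivity
    have h0 : HasDerivAt (fun x => x - m) 1 x := (hasDerivAt_id x).sub_const m
    have h1 : HasDerivAt (fun x => q ^ 2 + p ^ 2 * (x - m) ^ 2) (p ^ 2 * (2 * (x - m))) x := by
      simpa using ((h0.pow 2).const_mul (p ^ 2)).const_add (q ^ 2)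
    have h2 := h0.div h1 hv
    have h3 := (hasDerivAt_const x (1:ℝ)).div h1 hv
    have h4 := (h0.const_mul (p / q)).arctan
    have h5 := (((h2.mul h3).const_mul (1 / (4 * q ^ 2))).add
      (h2.const_mul (3 / (8 * q ^ 4)))).add (h4.const_mul (3 / (8 * q ^ 5 * p)))
    refine h5.congr_deriv ?_
    simp only [Pi.div_apply]
    have hw : 1 + (p / q * (x - m)) ^ 2 = (q ^ 2 + p ^ 2 * (x - m) ^ 2) / q ^ 2 := by
      field_simp
    rw [hw]
    field_simp
    ring
  have ht : Tendsto F atTop (𝓝 (1 / (4 * q ^ 2) * (0 * 0) + 3 / (8 * q ^ 4) * 0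
      + 3 / (8 * q ^ 5 * p) * (Real.pi / 2))) := by
    have a1 := (lim_div absTop (sq_pos_of_pos hp) (sq_pos_of_pos hq)).comp (shiftTop m)
    have a2 := (lim_inv absTop (sq_pos_of_pos hp) (sq_pos_of_pos hq)).comp (shiftTop m)
    exact (((a1.mul a2).const_mul _).add (a1.const_mul _)).add
      ((arctan_top (div_pos hp hq)).const_mul _)
  have hb : Tendsto F atBot (𝓝 (1 / (4 * q ^ 2) * (0 * 0) + 3 / (8 * q ^ 4) * 0
      + 3 / (8 * q ^ 5 * p) * (-(Real.pi / 2)))) := by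
    have a1 := (lim_div absBot (sq_pos_of_pos hp) (sq_pos_of_pos hq)).comp (shiftBot m)
    have a2 := (lim_inv absBot (sq_pos_of_pos hp) (sq_pos_of_pos hq)).comp (shiftBot m)
    exact (((a1.mul a2).const_mul _).add (a1.const_mul _)).add
      ((arctan_bot (div_pos hp hq)).const_mul _)
  have hn : ∀ x, 0 ≤ 1 / (q ^ 2 + p ^ 2 * (x - m) ^ 2) ^ 3 := fun x => by positivity
  have hi := integrable_line hd hn ht hb
  rw [← ofReal_integral_eq_lintegral_ofReal hi (Eventually.of_forall hn),
    integral_of_hasDerivAt_of_tendsto hd hi hb ht]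
  congr 1
  field_simp
  ring

/-- product of two Poisson kernels -/
lemma int_pair {s d y : ℝ} (hd : 0 < d) (hy : 0 < y) :
    Integrable (fun x : ℝ => 1 / ((y ^ 2 + (x - s) ^ 2) * (y ^ 2 + (x - s - d) ^ 2))) ∧
    ∫ x : ℝ, 1 / ((y ^ 2 + (x - s) ^ 2) * (y ^ 2 + (x - s - d) ^ 2))
      = 2 * Real.pi / (y * (d ^ 2 + 4 * y ^ 2)) := by
  let C : ℝ := 1 / (d * (d ^ 2 + 4 * y ^ 2))
  let F : ℝ → ℝ := fun x => C * (Real.log ((y ^ 2 + (x - s) ^ 2) / (y ^ 2 + (x - s - d) ^ 2))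
    + d / y * (Real.arctan (1 / y * (x - s)) + Real.arctan (1 / y * (x - (s + d)))))
  have hD : ∀ x, HasDerivAt F (1 / ((y ^ 2 + (x - s) ^ 2) * (y ^ 2 + (x - s - d) ^ 2))) x := by
    intro x
    have hv : y ^ 2 + (x - s) ^ 2 ≠ 0 := by positivity
    have hw : y ^ 2 + (x - s - d) ^ 2 ≠ 0 := by positivity
    have h0 : HasDerivAt (fun x => x - s) 1 x := (hasDerivAt_id x).sub_const s
    have k0 : HasDerivAt (fun x => x - s - d) 1 x := h0.sub_const d
    have k1 : HasDerivAt (fun x => x - (s + d)) 1 x := (hasDerivAt_id x).sub_const _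
    have h1 : HasDerivAt (fun x => y ^ 2 + (x - s) ^ 2) (2 * (x - s)) x := by
      simpa using (h0.pow 2).const_add (y ^ 2)
    have h2 : HasDerivAt (fun x => y ^ 2 + (x - s - d) ^ 2) (2 * (x - s - d)) x := by
      simpa using (k0.pow 2).const_add (y ^ 2)
    have h3 := (h1.div h2 hw).log (div_ne_zero hv hw)
    have h4 := (h0.const_mul (1 / y)).arctan
    have h5 := (k1.const_mul (1 / y)).arctan
    refine ((h3.add ((h4.add h5).const_mul (d / y))).const_mul C).congr_deriv ?_
    have e1 : 1 + (1 / y * (x - s)) ^ 2 = (y ^ 2 + (x - s) ^ 2) / y ^ 2 := by field_simp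
    have e2 : 1 + (1 / y * (x - (s + d))) ^ 2 = (y ^ 2 + (x - s - d) ^ 2) / y ^ 2 := by
      field_simp
      ring
    rw [e1, e2]
    simp only [C, Pi.div_apply]
    generalize hX : x - s = X at *
    have h7 : d ^ 2 + 4 * y ^ 2 ≠ 0 := by positivity
    field_simp
    ring
  have hlog : ∀ l : Filter ℝ, Tendsto (fun x : ℝ => |x - s - d|) l atTop →
      Tendsto (fun x => Real.log ((y ^ 2 + (x - s) ^ 2) / (y ^ 2 + (x - s - d) ^ 2))) l (𝓝 0) := by
    intro l hl
    have hl1 : Tendsto (fun x : ℝ => |x|) (map (fun x => x - s - d) l) atTop := hl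
    have a1 := (lim_div hl1 one_pos (sq_pos_of_pos hy))
    have a2 := (lim_inv hl1 one_pos (sq_pos_of_pos hy))
    rw [tendsto_map'_iff] at a1 a2
    have a3 := ((a1.const_mul (2 * d)).add (a2.const_mul (d ^ 2))).const_add 1
    have a4 : Tendsto (fun x => (y ^ 2 + (x - s) ^ 2) / (y ^ 2 + (x - s - d) ^ 2)) l (𝓝 1) := by
      convert a3 using 1
      · funext x
        have hw : y ^ 2 + (x - s - d) ^ 2 ≠ 0 := by positivity
        simp only [Function.comp, one_mul]
        field_simp
        ring
      · simp
    have := a4.log one_ne_zero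
    simpa using this
  have ht : Tendsto F atTop (𝓝 (C * (0 + d / y * (Real.pi / 2 + Real.pi / 2)))) := by
    refine ((hlog _ ?_).add (((arctan_top (by positivity)).add
      (arctan_top (by positivity))).const_mul _)).const_mul _
    exact (absTop.comp (shiftTop d)).comp (shiftTop s)
  have hb : Tendsto F atBot (𝓝 (C * (0 + d / y * (-(Real.pi / 2) + -(Real.pi / 2))))) := by
    refine ((hlog _ ?_).add (((arctan_bot (by positivity)).add
      (arctan_bot (by positivity))).const_mul _)).const_mul _
    exact (absBot.comp (shiftBot d)).comp (shiftBot s)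
  have hn : ∀ x, 0 ≤ 1 / ((y ^ 2 + (x - s) ^ 2) * (y ^ 2 + (x - s - d) ^ 2)) :=
    fun x => by positivity
  have hi := integrable_line hD hn ht hb
  refine ⟨hi, ?_⟩
  rw [integral_of_hasDerivAt_of_tendsto hD hi hb ht]
  simp only [C]
  field_simp
  ring

/-- y-integral -/
lemma lint_y {α c : ℝ} (hα : 0 < α) (hc : 0 < c) :
    ∫⁻ y in Ioi (0:ℝ), ENNReal.ofReal (y ^ 3 / (c + α * y ^ 2) ^ 5)
      = ENNReal.ofReal (1 / (24 * α ^ 2 * c ^ 3)) := by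
  let F : ℝ → ℝ := fun y => 1 / (2 * α ^ 2) * (c / 4 * (1 / (c + α * y ^ 2)) ^ 4
    - 1 / 3 * (1 / (c + α * y ^ 2)) ^ 3)
  have hl : Tendsto F atTop (𝓝 (1 / (2 * α ^ 2) * (c / 4 * 0 ^ 4 - 1 / 3 * 0 ^ 3))) := by
    have a := lim_inv absTop hα hc
    exact (((a.pow 4).const_mul _).sub ((a.pow 3).const_mul _)).const_mul _
  rw [lint_Ioi (F := F) (fun y _ => ?_) (fun y hy => ?_) hl]
  · congr 1
    simp only [F]
    field_simp
    ring
  · have hv : c + α * y ^ 2 ≠ 0 := by positivity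
    have h1 : HasDerivAt (fun y => c + α * y ^ 2) (α * (2 * y)) y := by
      simpa using (((hasDerivAt_id y).pow 2).const_mul α).const_add c
    have h3 := (hasDerivAt_const y (1:ℝ)).div h1 hv
    refine ((((h3.pow 4).const_mul (c / 4)).sub ((h3.pow 3).const_mul (1 / 3))).const_mul
      (1 / (2 * α ^ 2))).congr_deriv ?_
    simp only [Pi.div_apply]
    rw [show (4 - 1 : ℕ) = 3 from rfl, show (3 - 1 : ℕ) = 2 from rfl]
    push_cast
    field_simp
    ring
  · have : (0:ℝ) < y := hy
    positivity

/-- h-integral -/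
lemma lint_h (n : ℕ) {K p q : ℝ} (hK : 0 ≤ K) (hp : 0 < p) (hq : 0 < q) :
    ∫⁻ h in Ioi (0:ℝ), ENNReal.ofReal (K / (q + h * p) ^ (n + 2))
      = ENNReal.ofReal (K / ((n + 1) * p) / q ^ (n + 1)) := by
  let F : ℝ → ℝ := fun h => - (K / ((n + 1) * p)) * ((q + h * p)⁻¹) ^ (n + 1)
  have hl : Tendsto F atTop (𝓝 (- (K / ((n + 1) * p)) * 0 ^ (n + 1))) := by
    have : Tendsto (fun h : ℝ => q + h * p) atTop atTop :=
      tendsto_atTop_add_const_left _ _ (tendsto_id.atTop_mul_const hp)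
    exact (this.inv_tendsto_atTop.pow (n + 1)).const_mul _
  rw [lint_Ioi (F := F) (fun y hy => ?_) (fun y hy => ?_) hl]
  · congr 1
    simp only [F]
    simp
    field_simp
  · have : (0:ℝ) ≤ y := hy
    have hv : q + y * p ≠ 0 := by positivity
    have h1 : HasDerivAt (fun y => q + y * p) p y := by
      simpa using ((hasDerivAt_id y).mul_const p).const_add q
    refine (((h1.inv hv).pow (n + 1)).const_mul _).congr_deriv ?_
    rw [Nat.add_sub_cancel]
    push_cast
    simp only [Pi.inv_apply, inv_pow]
    have : (n:ℝ) + 1 ≠ 0 := by positivity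
    field_simp
    ring
  · have : (0:ℝ) < y := hy
    positivity

noncomputable def Qf (a b : ℝ) (h : ℝ × ℝ × ℝ × ℝ) (x y : ℝ) : ℝ :=
  1 + h.1 * (y ^ 2 + x ^ 2) + h.2.1 * (y ^ 2 + (x - 1) ^ 2) + h.2.2.1 * (y ^ 2 + (x - a) ^ 2)
    + h.2.2.2 * (y ^ 2 + (x - b) ^ 2)

noncomputable def Bf (u1 u2 : ℝ) (h : ℝ × ℝ × ℝ × ℝ) : ℝ :=
  (h.2.2.1 * (h.1 + h.2.1 + h.2.2.2) * u1 ^ 2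
            - 2 * h.2.2.1 * h.2.2.2 * u1 * u2
            + h.2.2.2 * (h.1 + h.2.1 + h.2.2.1) * u2 ^ 2)
          - 2 * h.2.1 * (h.2.2.1 * u1 + h.2.2.2 * u2)
          + ((1 + h.2.1) * (1 + h.1 + h.2.2.1 + h.2.2.2) - 1)

lemma Bf_pos (a b : ℝ) {h : ℝ × ℝ × ℝ × ℝ} (h2 : 0 < h.1) (h3 : 0 < h.2.1) (h4 : 0 < h.2.2.1)
    (h5 : 0 < h.2.2.2) : 0 < Bf a b h := by
  have : Bf a b h = h.1 + h.2.1 + h.2.2.1 + h.2.2.2 + h.1 * h.2.1 + h.1 * h.2.2.1 * a ^ 2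
    + h.1 * h.2.2.2 * b ^ 2 + h.2.1 * h.2.2.1 * (a - 1) ^ 2 + h.2.1 * h.2.2.2 * (b - 1) ^ 2
    + h.2.2.1 * h.2.2.2 * (b - a) ^ 2 := by
    unfold Bf; ring
  rw [this]
  positivity

lemma half_plane (a b : ℝ) {h : ℝ × ℝ × ℝ × ℝ} (h2 : 0 < h.1) (h3 : 0 < h.2.1)
    (h4 : 0 < h.2.2.1) (h5 : 0 < h.2.2.2) :
    ∫⁻ x : ℝ, ∫⁻ y in Ioi (0:ℝ), ENNReal.ofReal (y ^ 3 / Qf a b h x y ^ 5)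
      = ENNReal.ofReal (Real.pi / 64) * ENNReal.ofReal (Bf a b h ^ (-(5:ℝ)/2)) := by
  have hB := Bf_pos a b h2 h3 h4 h5
  set B := Bf a b h with hBdef
  obtain ⟨α, hα⟩ : ∃ α, α = h.1 + h.2.1 + h.2.2.1 + h.2.2.2 := ⟨_, rfl⟩
  obtain ⟨β, hβ⟩ : ∃ β, β = h.2.1 + h.2.2.1 * a + h.2.2.2 * b := ⟨_, rfl⟩
  have hα0 : 0 < α := by rw [hα]; positivity
  have hQ : ∀ x y, Qf a b h x y = (B / α + α * (x - β / α) ^ 2) + α * y ^ 2 := by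
    intro x y
    have : B / α + α * (x - β / α) ^ 2 = (B + β ^ 2) / α + α * x ^ 2 - 2 * β * x := by
      field_simp
      ring
    rw [this]
    have h6 : (B + β ^ 2) / α = 1 + h.2.1 + h.2.2.1 * a ^ 2 + h.2.2.2 * b ^ 2 := by
      rw [div_eq_iff hα0.ne', hα, hβ, hBdef]
      unfold Bf
      ring
    rw [h6, hα, hβ]
    unfold Qf
    ring
  have hy : ∀ x, ∫⁻ y in Ioi (0:ℝ), ENNReal.ofReal (y ^ 3 / Qf a b h x y ^ 5)
      = ENNReal.ofReal (1 / (24 * α ^ 2)) * ENNReal.ofReal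
        (1 / (√(B / α) ^ 2 + √α ^ 2 * (x - β / α) ^ 2) ^ 3) := by
    intro x
    simp_rw [hQ]
    rw [lint_y hα0 (by positivity), ← ENNReal.ofReal_mul (by positivity),
      Real.sq_sqrt (by positivity), Real.sq_sqrt hα0.le]
    congr 1
    field_simp
  simp_rw [hy]
  rw [lintegral_const_mul _ (by fun_prop), lint_cubic (by positivity) (by positivity),
    ← ENNReal.ofReal_mul (by positivity), ← ENNReal.ofReal_mul (by positivity)]
  congr 1
  have e1 : B ^ (-(5:ℝ)/2) = (√B ^ 5)⁻¹ := by
    rw [neg_div, Real.rpow_neg hB.le, Real.sqrt_eq_rpow, ← Real.rpow_natCast, ← Real.rpow_mul hB.le]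
    norm_num
  rw [e1, Real.sqrt_div hB.le]
  have hs : 0 < √α := Real.sqrt_pos.2 hα0
  have hs2 : 0 < √B := Real.sqrt_pos.2 hB
  nth_rewrite 1 [← Real.sq_sqrt hα0.le]
  generalize √α = r at *
  generalize √B = s at *
  field_simp
  norm_num

lemma h_int (a b x : ℝ) {y : ℝ} (hy : 0 < y) :
    ∫⁻ h in (Set.Ioi (0:ℝ) ×ˢ (Set.Ioi (0:ℝ) ×ˢ (Set.Ioi (0:ℝ) ×ˢ Set.Ioi (0:ℝ)))),
      ENNReal.ofReal (y ^ 3 / Qf a b h x y ^ 5)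
    = ENNReal.ofReal (y ^ 3 / 24 * (1 / ((y ^ 2 + x ^ 2) * (y ^ 2 + (x - 1) ^ 2) *
      (y ^ 2 + (x - a) ^ 2) * (y ^ 2 + (x - b) ^ 2)))) := by
  have hp0 : 0 < y ^ 2 + x ^ 2 := by positivity
  have hp1 : 0 < y ^ 2 + (x - 1) ^ 2 := by positivity
  have hpa : 0 < y ^ 2 + (x - a) ^ 2 := by positivity
  have hpb : 0 < y ^ 2 + (x - b) ^ 2 := by positivity
  simp only [Qf]
  generalize y ^ 2 + x ^ 2 = p0 at *
  generalize y ^ 2 + (x - 1) ^ 2 = p1 at *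
  generalize y ^ 2 + (x - a) ^ 2 = p2 at *
  generalize y ^ 2 + (x - b) ^ 2 = p3 at *
  have e : (volume : Measure (ℝ × ℝ × ℝ × ℝ)).restrict
      (Set.Ioi (0:ℝ) ×ˢ (Set.Ioi (0:ℝ) ×ˢ (Set.Ioi (0:ℝ) ×ˢ Set.Ioi (0:ℝ))))
      = (volume.restrict (Ioi (0:ℝ))).prod ((volume.restrict (Ioi (0:ℝ))).prod
        ((volume.restrict (Ioi (0:ℝ))).prod (volume.restrict (Ioi (0:ℝ))))) := by
    simp only [Measure.prod_restrict]
    rfl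
  rw [e, lintegral_prod _ (by fun_prop)]
  have s1 : ∀ h2 ∈ Ioi (0:ℝ), ∀ h3 ∈ Ioi (0:ℝ), ∀ h4 ∈ Ioi (0:ℝ),
      ∫⁻ h5 in Ioi (0:ℝ), ENNReal.ofReal
        (y ^ 3 / (1 + h2 * p0 + h3 * p1 + h4 * p2 + h5 * p3) ^ 5)
      = ENNReal.ofReal (y ^ 3 / (4 * p3) / (1 + h2 * p0 + h3 * p1 + h4 * p2) ^ 4) := by
    intro h2 hh2 h3 hh3 h4 hh4
    simp only [mem_Ioi] at hh2 hh3 hh4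
    rw [lint_h 3 (by positivity) hpb (by positivity)]
    norm_num
  have s2 : ∀ h2 ∈ Ioi (0:ℝ), ∀ h3 ∈ Ioi (0:ℝ),
      ∫⁻ h4 in Ioi (0:ℝ), ENNReal.ofReal
        (y ^ 3 / (4 * p3) / (1 + h2 * p0 + h3 * p1 + h4 * p2) ^ 4)
      = ENNReal.ofReal (y ^ 3 / (4 * p3) / (3 * p2) / (1 + h2 * p0 + h3 * p1) ^ 3) := by
    intro h2 hh2 h3 hh3
    simp only [mem_Ioi] at hh2 hh3
    rw [lint_h 2 (by positivity) hpa (by positivity)]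
    norm_num
  have s3 : ∀ h2 ∈ Ioi (0:ℝ),
      ∫⁻ h3 in Ioi (0:ℝ), ENNReal.ofReal
        (y ^ 3 / (4 * p3) / (3 * p2) / (1 + h2 * p0 + h3 * p1) ^ 3)
      = ENNReal.ofReal (y ^ 3 / (4 * p3) / (3 * p2) / (2 * p1) / (1 + h2 * p0) ^ 2) := by
    intro h2 hh2
    simp only [mem_Ioi] at hh2
    rw [lint_h 1 (by positivity) hp1 (by positivity)]
    norm_num
  have s4 : ∀ h2 ∈ Ioi (0:ℝ),
      ∫⁻ z, ENNReal.ofReal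
        (y ^ 3 / (1 + h2 * p0 + z.1 * p1 + z.2.1 * p2 + z.2.2 * p3) ^ 5)
        ∂((volume.restrict (Ioi (0:ℝ))).prod
        ((volume.restrict (Ioi (0:ℝ))).prod (volume.restrict (Ioi (0:ℝ)))))
      = ENNReal.ofReal (y ^ 3 / (4 * p3) / (3 * p2) / (2 * p1) / (1 + h2 * p0) ^ 2) := by
    intro h2 hh2
    rw [lintegral_prod _ (by fun_prop), ← s3 h2 hh2]
    refine setLIntegral_congr_fun measurableSet_Ioi fun h3 hh3 => ?_
    simp only
    rw [lintegral_prod _ (by fun_prop), ← s2 h2 hh2 h3 hh3]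
    exact setLIntegral_congr_fun measurableSet_Ioi fun h4 hh4 => s1 h2 hh2 h3 hh3 h4 hh4
  rw [setLIntegral_congr_fun measurableSet_Ioi s4]
  rw [lint_h 0 (by positivity) hp0 one_pos]
  congr 1
  field_simp
  norm_num

noncomputable def Hval (a b y : ℝ) : ℝ :=
  -(Real.pi / 48) * (
        1 / (a * b * (a - 1) * (b - 1)) * (1 ^ 2 / (1 ^ 2 + 4 * y ^ 2))
      - 1 / ((a - 1) * b * (b - a)) * (a ^ 2 / (a ^ 2 + 4 * y ^ 2))
      + 1 / ((b - 1) * a * (b - a)) * (b ^ 2 / (b ^ 2 + 4 * y ^ 2))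
      + 1 / (a * (b - 1) * (b - a)) * ((a - 1) ^ 2 / ((a - 1) ^ 2 + 4 * y ^ 2))
      - 1 / (b * (a - 1) * (b - a)) * ((b - 1) ^ 2 / ((b - 1) ^ 2 + 4 * y ^ 2))
      + 1 / (a * b * (a - 1) * (b - 1)) * ((b - a) ^ 2 / ((b - a) ^ 2 + 4 * y ^ 2)))

lemma comb {f g h : ℝ → ℝ} {v w : ℝ} (c : ℝ) (hf : Integrable f ∧ ∫ x, f x = v)
    (hg : Integrable g ∧ ∫ x, g x = w) (hh : ∀ x, h x = f x + c * g x) :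
    Integrable h ∧ ∫ x, h x = v + c * w := by
  obtain rfl : h = fun x => f x + c * g x := funext hh
  exact ⟨hf.1.add (hg.1.const_mul c), by
    rw [integral_add hf.1 (hg.1.const_mul c), integral_const_mul, hf.2, hg.2]⟩

lemma x_int {a b y : ℝ} (ha : 1 < a) (hb : a < b) (hy : 0 < y) :
    ∫⁻ x : ℝ, ENNReal.ofReal (y ^ 3 / 24 * (1 / ((y ^ 2 + x ^ 2) * (y ^ 2 + (x - 1) ^ 2) *
      (y ^ 2 + (x - a) ^ 2) * (y ^ 2 + (x - b) ^ 2))))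
    = ENNReal.ofReal (Hval a b y) ∧ 0 ≤ Hval a b y := by
  have d1 : 0 < a - 1 := by linarith
  have d2 : 0 < b - 1 := by linarith
  have d3 : 0 < b - a := by linarith
  have a0 : 0 < a := by linarith
  have b0 : 0 < b := by linarith
  have z : Integrable (fun _ : ℝ => (0:ℝ)) ∧ ∫ _ : ℝ, (0:ℝ) = 0 := ⟨integrable_zero _ _ _, by simp⟩
  have key := comb (1 / (a * b * (a - 1) * (b - 1)))
    (comb (-(1 / (b * (a - 1) * (b - a))))
    (comb (1 / (a * (b - 1) * (b - a)))
    (comb (1 / ((b - 1) * a * (b - a)))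
    (comb (-(1 / ((a - 1) * b * (b - a))))
    (comb (1 / (a * b * (a - 1) * (b - 1))) z
    (int_pair (s := 0) one_pos hy) (fun x => rfl))
    (int_pair (s := 0) a0 hy) (fun x => rfl))
    (int_pair (s := 0) b0 hy) (fun x => rfl))
    (int_pair (s := 1) d1 hy) (fun x => rfl))
    (int_pair (s := 1) d2 hy) (fun x => rfl))
    (int_pair (s := a) d3 hy)
    (h := fun x => 1 / ((y ^ 2 + x ^ 2) * (y ^ 2 + (x - 1) ^ 2) *
      (y ^ 2 + (x - a) ^ 2) * (y ^ 2 + (x - b) ^ 2))) (by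
      intro x
      have hp0 : 0 < y ^ 2 + x ^ 2 := by positivity
      have hp1 : 0 < y ^ 2 + (x - 1) ^ 2 := by positivity
      have hpa : 0 < y ^ 2 + (x - a) ^ 2 := by positivity
      have hpb : 0 < y ^ 2 + (x - b) ^ 2 := by positivity
      rw [show x - 1 - (a - 1) = x - a by ring, show x - 1 - (b - 1) = x - b by ring,
        show x - a - (b - a) = x - b by ring, sub_zero]
      field_simp
      ring)
  obtain ⟨hi, hv⟩ := key
  have hn : ∀ x, 0 ≤ y ^ 3 / 24 * (1 / ((y ^ 2 + x ^ 2) * (y ^ 2 + (x - 1) ^ 2) *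
      (y ^ 2 + (x - a) ^ 2) * (y ^ 2 + (x - b) ^ 2))) := fun x => by positivity
  have hsum : 1 / (a * b * (a - 1) * (b - 1)) - 1 / ((a - 1) * b * (b - a))
      + 1 / ((b - 1) * a * (b - a)) + 1 / (a * (b - 1) * (b - a)) - 1 / (b * (a - 1) * (b - a))
      + 1 / (a * b * (a - 1) * (b - 1)) = 0 := by
    field_simp
    ring
  have ht : ∀ t : ℝ, 2 * Real.pi / (y * (t ^ 2 + 4 * y ^ 2))
      = Real.pi / (2 * y ^ 3) * (1 - t ^ 2 / (t ^ 2 + 4 * y ^ 2)) := by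
    intro t
    have : 0 < t ^ 2 + 4 * y ^ 2 := by positivity
    field_simp
    ring
  have hval : ∫ x : ℝ, y ^ 3 / 24 * (1 / ((y ^ 2 + x ^ 2) * (y ^ 2 + (x - 1) ^ 2) *
      (y ^ 2 + (x - a) ^ 2) * (y ^ 2 + (x - b) ^ 2))) = Hval a b y := by
    rw [integral_const_mul, hv]
    simp only [ht, Hval]
    generalize 1 ^ 2 / (1 ^ 2 + 4 * y ^ 2) = w1
    generalize a ^ 2 / (a ^ 2 + 4 * y ^ 2) = w2
    generalize b ^ 2 / (b ^ 2 + 4 * y ^ 2) = w3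
    generalize (a - 1) ^ 2 / ((a - 1) ^ 2 + 4 * y ^ 2) = w4
    generalize (b - 1) ^ 2 / ((b - 1) ^ 2 + 4 * y ^ 2) = w5
    generalize (b - a) ^ 2 / ((b - a) ^ 2 + 4 * y ^ 2) = w6
    have hy3 : y ^ 3 / 24 * (Real.pi / (2 * y ^ 3)) = Real.pi / 48 := by
      field_simp
      norm_num
    rw [← hy3]
    linear_combination (y ^ 3 / 24 * (Real.pi / (2 * y ^ 3))) * hsum
  refine ⟨?_, ?_⟩
  · rw [← hval, ofReal_integral_eq_lintegral_ofReal (hi.const_mul _) (Eventually.of_forall hn)]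
  · rw [← hval]
    exact integral_nonneg hn

lemma y_int {a b : ℝ} (ha : 1 < a) (hb : a < b) :
    ∫⁻ y in Ioi (0:ℝ), ENNReal.ofReal (Hval a b y)
      = ENNReal.ofReal (Real.pi ^ 2 / (96 * (a * b * (b - 1)))) := by
  have d1 : 0 < a - 1 := by linarith
  have d2 : 0 < b - 1 := by linarith
  have d3 : 0 < b - a := by linarith
  have a0 : 0 < a := by linarith
  have b0 : 0 < b := by linarith
  have hD : ∀ {t : ℝ}, 0 < t → ∀ y, HasDerivAt
      (fun y => t / 2 * Real.arctan (2 / t * (y - 0))) (t ^ 2 / (t ^ 2 + 4 * y ^ 2)) y := by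
    intro t ht y
    have h0 : HasDerivAt (fun x : ℝ => x - 0) 1 y := (hasDerivAt_id y).sub_const 0
    refine (((h0.const_mul (2 / t)).arctan).const_mul (t / 2)).congr_deriv ?_
    have e1 : 1 + (2 / t * (y - 0)) ^ 2 = (t ^ 2 + 4 * y ^ 2) / t ^ 2 := by
      field_simp
      ring
    rw [e1]
    have : 0 < t ^ 2 + 4 * y ^ 2 := by positivity
    field_simp
  have hL : ∀ {t : ℝ}, 0 < t → Tendsto
      (fun y => t / 2 * Real.arctan (2 / t * (y - 0))) atTop (𝓝 (t / 2 * (Real.pi / 2))) :=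
    fun {t} ht => (arctan_top (by positivity)).const_mul _
  have HD := fun y => (((((((hD one_pos y).const_mul (1 / (a * b * (a - 1) * (b - 1)))).sub
    ((hD a0 y).const_mul (1 / ((a - 1) * b * (b - a))))).add
    ((hD b0 y).const_mul (1 / ((b - 1) * a * (b - a))))).add
    ((hD d1 y).const_mul (1 / (a * (b - 1) * (b - a))))).sub
    ((hD d2 y).const_mul (1 / (b * (a - 1) * (b - a))))).add
    ((hD d3 y).const_mul (1 / (a * b * (a - 1) * (b - 1))))).const_mul (-(Real.pi / 48))
  have HL := (((((((hL one_pos).const_mul (1 / (a * b * (a - 1) * (b - 1)))).sub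
    ((hL a0).const_mul (1 / ((a - 1) * b * (b - a))))).add
    ((hL b0).const_mul (1 / ((b - 1) * a * (b - a))))).add
    ((hL d1).const_mul (1 / (a * (b - 1) * (b - a))))).sub
    ((hL d2).const_mul (1 / (b * (a - 1) * (b - a))))).add
    ((hL d3).const_mul (1 / (a * b * (a - 1) * (b - 1))))).const_mul (-(Real.pi / 48))
  refine (lint_Ioi (fun y _ => HD y) (fun y hy => (x_int ha hb hy).2) HL).trans ?_
  congr 1
  simp
  field_simp
  ring

theorem stmt6 (u1 u2 : ℝ) (hu1 : 1 < u1) (hu2 : u1 < u2) :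
    (∫ h in (Set.Ioi (0:ℝ) ×ˢ (Set.Ioi (0:ℝ) ×ˢ (Set.Ioi (0:ℝ) ×ˢ Set.Ioi (0:ℝ)))),
        ((h.2.2.1 * (h.1 + h.2.1 + h.2.2.2) * u1 ^ 2
            - 2 * h.2.2.1 * h.2.2.2 * u1 * u2
            + h.2.2.2 * (h.1 + h.2.1 + h.2.2.1) * u2 ^ 2)
          - 2 * h.2.1 * (h.2.2.1 * u1 + h.2.2.2 * u2)
          + ((1 + h.2.1) * (1 + h.1 + h.2.2.1 + h.2.2.2) - 1)) ^ (-(5:ℝ)/2))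
      = (2 * Real.pi / 3) / (u1 * u2 * (u2 - 1)) := by
  set S : Set (ℝ × ℝ × ℝ × ℝ) :=
    Set.Ioi (0:ℝ) ×ˢ (Set.Ioi (0:ℝ) ×ˢ (Set.Ioi (0:ℝ) ×ˢ Set.Ioi (0:ℝ))) with hS
  have hSm : MeasurableSet S := measurableSet_Ioi.prod
    (measurableSet_Ioi.prod (measurableSet_Ioi.prod measurableSet_Ioi))
  change ∫ h in S, Bf u1 u2 h ^ (-(5:ℝ)/2) = _
  have hBm : Measurable (fun h => Bf u1 u2 h ^ (-(5:ℝ)/2)) := by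
    unfold Bf
    fun_prop
  have hpos : ∀ h ∈ S, 0 < Bf u1 u2 h := fun h hh => Bf_pos u1 u2 hh.1 hh.2.1 hh.2.2.1 hh.2.2.2
  rw [integral_eq_lintegral_of_nonneg_ae ((ae_restrict_iff' hSm).2
    (Eventually.of_forall fun h hh => (Real.rpow_pos_of_pos (hpos h hh) _).le))
    hBm.aestronglyMeasurable]
  have d2 : 0 < u2 - 1 := by linarith
  have a0 : 0 < u1 := by linarith
  have b0 : 0 < u2 := by linarith
  have main : ENNReal.ofReal (Real.pi / 64) *
      ∫⁻ h in S, ENNReal.ofReal (Bf u1 u2 h ^ (-(5:ℝ)/2))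
      = ENNReal.ofReal (Real.pi ^ 2 / (96 * (u1 * u2 * (u2 - 1)))) := by
    rw [← lintegral_const_mul _ hBm.ennreal_ofReal]
    have m1 : Measurable (fun p : ((ℝ × ℝ × ℝ × ℝ) × ℝ) × ℝ =>
        ENNReal.ofReal (p.2 ^ 3 / Qf u1 u2 p.1.1 p.1.2 p.2 ^ 5)) := by
      unfold Qf
      fun_prop
    calc _ = ∫⁻ h in S, ∫⁻ x : ℝ, ∫⁻ y in Ioi (0:ℝ),
            ENNReal.ofReal (y ^ 3 / Qf u1 u2 h x y ^ 5) :=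
          setLIntegral_congr_fun hSm fun h hh =>
            (half_plane u1 u2 hh.1 hh.2.1 hh.2.2.1 hh.2.2.2).symm
      _ = ∫⁻ x : ℝ, ∫⁻ h in S, ∫⁻ y in Ioi (0:ℝ),
            ENNReal.ofReal (y ^ 3 / Qf u1 u2 h x y ^ 5) :=
          lintegral_lintegral_swap (m1.lintegral_prod_right').aemeasurable
      _ = ∫⁻ x : ℝ, ∫⁻ y in Ioi (0:ℝ), ∫⁻ h in S,
            ENNReal.ofReal (y ^ 3 / Qf u1 u2 h x y ^ 5) := by
          refine lintegral_congr fun x => lintegral_lintegral_swap ?_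
          exact (m1.comp (f := fun q : (ℝ × ℝ × ℝ × ℝ) × ℝ => ((q.1, x), q.2))
            (by fun_prop)).aemeasurable
      _ = ∫⁻ x : ℝ, ∫⁻ y in Ioi (0:ℝ), ENNReal.ofReal (y ^ 3 / 24 *
            (1 / ((y ^ 2 + x ^ 2) * (y ^ 2 + (x - 1) ^ 2) *
            (y ^ 2 + (x - u1) ^ 2) * (y ^ 2 + (x - u2) ^ 2)))) :=
          lintegral_congr fun x => setLIntegral_congr_fun measurableSet_Ioi fun y hy =>
            h_int u1 u2 x hy
      _ = ∫⁻ y in Ioi (0:ℝ), ∫⁻ x : ℝ, ENNReal.ofReal (y ^ 3 / 24 *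
            (1 / ((y ^ 2 + x ^ 2) * (y ^ 2 + (x - 1) ^ 2) *
            (y ^ 2 + (x - u1) ^ 2) * (y ^ 2 + (x - u2) ^ 2)))) := by
          refine lintegral_lintegral_swap ?_
          unfold Function.uncurry
          fun_prop
      _ = ∫⁻ y in Ioi (0:ℝ), ENNReal.ofReal (Hval u1 u2 y) :=
          setLIntegral_congr_fun measurableSet_Ioi fun y hy => (x_int hu1 hu2 hy).1
      _ = _ := y_int hu1 hu2
  have main2 := congrArg ENNReal.toReal main
  rw [ENNReal.toReal_mul, ENNReal.toReal_ofReal (by positivity),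
    ENNReal.toReal_ofReal (by positivity)] at main2
  have hpi := Real.pi_pos
  have h64 : Real.pi / 64 ≠ 0 := by positivity
  apply mul_left_cancel₀ h64
  rw [main2]
  field_simp
  norm_num
end

section
/- Define, for real numbers x2, x3, x4 pairwise distinct and all different from 0 and 1: ε3(x2,x3,x4) = x2²·log|x2|/(x3·x4·(x2−1)(x2−x3)(x2−x4)) − x3²·log|x3|/(x2·x4·(x2−x3)(x3−1)(x3−x4)) + x4²·log|x4|/(x2·x3·(x4−1)(x2−x4)(x3−x4)) − (x2−1)²·log|x2−1|/(x2·(x2−x3)(x2−x4)(x3−1)(x4−1)) − (x2−x3)²·log|x2−x3|/(x2·x3·(x2−1)(x2−x4)(x3−1)(x3−x4)) + (x2−x4)²·log|x2−x4|/(x2·x4·(x2−1)(x4−1)(x2−x3)(x3−x4)) + (x3−1)²·log|x3−1|/(x3·(x2−1)(x4−1)(x2−x3)(x3−x4)) − (x3−x4)²·log|x3−x4|/(x3·x4·(x4−1)(x3−1)(x2−x3)(x2−x4)) − (x4−1)²·log|x4−1|/(x4·(x2−1)(x3−1)(x2−x4)(x3−x4)). Then for all reals with 1 < x2 < x3 <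 x4 the following two identities hold: (1) ε3( x4/(x4−1), x4/(x4−x2), x4/(x4−x3) ) = ε3(x2,x3,x4) · (x4−1)²·(x4−x2)²·(x4−x3)²/x4²; (2) ε3( (x4−x2)/(x4−x3), (x4−1)/(x4−x3), x4/(x4−x3) ) = ε3(x2,x3,x4) · (x4−x3)⁴. -/
/-- The explicit rational–logarithmic function `ε₃` (component of Euler's abelian relation
`E₄` of the web `W_{0,7}`). -/
noncomputable def eps3 (x2 x3 x4 : ℝ) : ℝ :=
  x2 ^ 2 * Real.log |x2| / (x3 * x4 * (x2 - 1) * (x2 - x3) * (x2 - x4))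
    - x3 ^ 2 * Real.log |x3| / (x2 * x4 * (x2 - x3) * (x3 - 1) * (x3 - x4))
    + x4 ^ 2 * Real.log |x4| / (x2 * x3 * (x4 - 1) * (x2 - x4) * (x3 - x4))
    - (x2 - 1) ^ 2 * Real.log |x2 - 1| / (x2 * (x2 - x3) * (x2 - x4) * (x3 - 1) * (x4 - 1))
    - (x2 - x3) ^ 2 * Real.log |x2 - x3| /
        (x2 * x3 * (x2 - 1) * (x2 - x4) * (x3 - 1) * (x3 - x4))
    + (x2 - x4) ^ 2 * Real.log |x2 - x4| /
        (x2 * x4 * (x2 - 1) * (x4 - 1) * (x2 - x3) * (x3 - x4))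
    + (x3 - 1) ^ 2 * Real.log |x3 - 1| / (x3 * (x2 - 1) * (x4 - 1) * (x2 - x3) * (x3 - x4))
    - (x3 - x4) ^ 2 * Real.log |x3 - x4| /
        (x3 * x4 * (x4 - 1) * (x3 - 1) * (x2 - x3) * (x2 - x4))
    - (x4 - 1) ^ 2 * Real.log |x4 - 1| / (x4 * (x2 - 1) * (x3 - 1) * (x2 - x4) * (x3 - x4))

/-- the transformation formulas of `ε₃` under the cyclic automorphism `C` and
the dihedral reflection `R` of the positive moduli space `M_{0,7}^{>0}`. -/
theorem stmt11 (x2 x3 x4 : ℝ) (h2 : 1 < x2) (h3 : x2 < x3) (h4 : x3 < x4) :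
    eps3 (x4 / (x4 - 1)) (x4 / (x4 - x2)) (x4 / (x4 - x3))
        = eps3 x2 x3 x4 * ((x4 - 1) ^ 2 * (x4 - x2) ^ 2 * (x4 - x3) ^ 2 / x4 ^ 2) ∧
      eps3 ((x4 - x2) / (x4 - x3)) ((x4 - 1) / (x4 - x3)) (x4 / (x4 - x3))
        = eps3 x2 x3 x4 * (x4 - x3) ^ 4 := by
  obtain ⟨u, hu⟩ : ∃ u, u = x2 - 1 := ⟨_, rfl⟩
  obtain ⟨v, hv⟩ : ∃ u, u = x3 - 1 := ⟨_, rfl⟩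
  obtain ⟨w, hw⟩ : ∃ u, u = x4 - 1 := ⟨_, rfl⟩
  obtain ⟨s, hs⟩ : ∃ u, u = x3 - x2 := ⟨_, rfl⟩
  obtain ⟨t, ht⟩ : ∃ u, u = x4 - x2 := ⟨_, rfl⟩
  obtain ⟨r, hr⟩ : ∃ u, u = x4 - x3 := ⟨_, rfl⟩
  have p2 : x2 ≠ 0 := by linarith
  have p3 : x3 ≠ 0 := by linarith
  have p4 : x4 ≠ 0 := by linarith
  have pu : u ≠ 0 := by linarith
  have pv : v ≠ 0 := by linarith
  have pw : w ≠ 0 := by linarith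
  have ps : s ≠ 0 := by linarith
  have pt : t ≠ 0 := by linarith
  have pr : r ≠ 0 := by linarith
  have e1 : x2 - x3 = -s := by rw [hs]; ring
  have e2 : x2 - x4 = -t := by rw [ht]; ring
  have e3 : x3 - x4 = -r := by rw [hr]; ring
  have E : eps3 x2 x3 x4 = x2 ^ 2 * Real.log x2 / (x3 * x4 * u * s * t)
      - x3 ^ 2 * Real.log x3 / (x2 * x4 * s * v * r)
      + x4 ^ 2 * Real.log x4 / (x2 * x3 * w * t * r)
      - u ^ 2 * Real.log u / (x2 * s * t * v * w)
      - s ^ 2 * Real.log s / (x2 * x3 * u * t * v * r)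
      + t ^ 2 * Real.log t / (x2 * x4 * u * w * s * r)
      + v ^ 2 * Real.log v / (x3 * u * w * s * r)
      - r ^ 2 * Real.log r / (x3 * x4 * w * v * s * t)
      - w ^ 2 * Real.log w / (x4 * u * v * t * r) := by
    unfold eps3
    rw [e1, e2, e3, ← hu, ← hv, ← hw]
    simp only [abs_neg, Real.log_abs]
    field_simp
  rw [E, ← hw, ← ht, ← hr]
  clear E
  constructor
  · have f1 : x4 / w - 1 = 1 / w := by field_simp; rw [hw]; ring
    have f2 : x4 / t - 1 = x2 / t := by field_simp; rw [ht]; ring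
    have f3 : x4 / r - 1 = x3 / r := by field_simp; rw [hr]; ring
    have f4 : x4 / w - x4 / t = - (x4 * u / (w * t)) := by field_simp; rw [hw, ht, hu]; ring
    have f5 : x4 / w - x4 / r = - (x4 * v / (w * r)) := by field_simp; rw [hw, hr, hv]; ring
    have f6 : x4 / t - x4 / r = - (x4 * s / (t * r)) := by field_simp; rw [ht, hr, hs]; ring
    unfold eps3
    rw [f1, f2, f3, f4, f5, f6]
    simp only [abs_neg, Real.log_abs]
    rw [Real.log_div p4 pw, Real.log_div p4 pt, Real.log_div p4 pr, Real.log_div one_ne_zero pw,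
      Real.log_div p2 pt, Real.log_div p3 pr, Real.log_div (mul_ne_zero p4 pu) (mul_ne_zero pw pt),
      Real.log_div (mul_ne_zero p4 pv) (mul_ne_zero pw pr),
      Real.log_div (mul_ne_zero p4 ps) (mul_ne_zero pt pr), Real.log_mul p4 pu, Real.log_mul p4 pv,
      Real.log_mul p4 ps, Real.log_mul pw pt, Real.log_mul pw pr, Real.log_mul pt pr, Real.log_one]
    clear f1 f2 f3 f4 f5 f6 e1 e2 e3
    generalize Real.log x2 = l1
    generalize Real.log x3 = l2
    generalize Real.log x4 = l3
    generalize Real.log u = l4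
    generalize Real.log v = l5
    generalize Real.log w = l6
    generalize Real.log s = l7
    generalize Real.log t = l8
    generalize Real.log r = l9
    field_simp
    rw [hu, hv, hw, hs, ht, hr]
    ring
  · have f1 : t / r - 1 = s / r := by field_simp; rw [hs, ht, hr]; ring
    have f2 : w / r - 1 = v / r := by field_simp; rw [hw, hr, hv]; ring
    have f3 : x4 / r - 1 = x3 / r := by field_simp; rw [hr]; ring
    have f4 : t / r - w / r = - (u / r) := by field_simp; rw [hw, ht, hu]; ring
    have f5 : t / r - x4 / r = - (x2 / r) := by field_simp; rw [ht]; ring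
    have f6 : w / r - x4 / r = - (1 / r) := by field_simp; rw [hw]; ring
    unfold eps3
    rw [f1, f2, f3, f4, f5, f6]
    simp only [abs_neg, Real.log_abs]
    rw [Real.log_div pt pr, Real.log_div pw pr, Real.log_div p4 pr, Real.log_div ps pr,
      Real.log_div pv pr, Real.log_div p3 pr, Real.log_div pu pr, Real.log_div p2 pr,
      Real.log_div one_ne_zero pr, Real.log_one]
    clear f1 f2 f3 f4 f5 f6 e1 e2 e3
    generalize Real.log x2 = l1
    generalize Real.log x3 = l2
    generalize Real.log x4 = l3
    generalize Real.log u = l4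
    generalize Real.log v = l5
    generalize Real.log w = l6
    generalize Real.log s = l7
    generalize Real.log t = l8
    generalize Real.log r = l9
    field_simp
    rw [hu, hv, hw, hs, ht, hr]
    ring
end

section
/- Let n be an even integer with 2 ≤ n ≤ 12. For a real tuple (x2,…,xn), set x_{n+1} = 0 and x_{n+2} = 1 and define ε_{n−1}(x2,…,xn) = (1/M)·Σ (−1)^{j−i}·P_{ij}·(xi − xj)^{n−1}·log|xi − xj|, the sum being over pairs (i,j) with 2 ≤ i ≤ n and i < j ≤ n+2, where M = Π_{2 ≤ p < q ≤ n+2} (xp − xq) and P_{ij} = Π (xp − xq), this last product being over pairs p < q with p, q ∈ {2,…,n+2} \ {i, j}. Let Ω ⊂ ℝⁿ be the set of x = (x1,…,xn) with every xi ∉ {0,1} and xi ≠ xj for i ≠ j, and let C : Ω → Ω be the map C(x) = ((1−x2)/(x1−x2), …, (1−xn)/(x1−xn), 1/x1) (C maps Ω into Ω). For i = 1,…,n+3 let V_i : Ω → ℝ^{n−1} be the map whose components are the coordinates 2,…,n of the (i−1)-fold iterate C^{∘(i−1)}. Then for every x ∈ Ω with 1 < x1 < x2 < … < xn and all vectors w1,…,w_{n−1}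 ∈ ℝⁿ: Σ_{i=1}^{n+3} ε_{n−1}(V_i(x)) · det M_i = 0, where M_i is the (n−1)×(n−1) matrix whose (a,b) entry is the directional derivative at x of the a-th component of V_i in the direction w_b. -/
/-- The cyclic birational map `C(x) = ((1−x₂)/(x₁−x₂), …, (1−xₙ)/(x₁−xₙ), 1/x₁)` on `ℝⁿ`
(indices written 0-based). -/
noncomputable def cyc (n : ℕ) (x : Fin n → ℝ) : Fin n → ℝ := fun i =>
  if h : (i : ℕ) + 1 < n then
    (1 - x ⟨(i : ℕ) + 1, h⟩) / (x ⟨0, by have := i.isLt; omega⟩ - x ⟨(i : ℕ) + 1, h⟩)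
  else 1 / x ⟨0, by have := i.isLt; omega⟩

/-- The first integral `V_{j+1}` of the web `W_{0,n+3}`: the coordinates `2,…,n` of the
`j`-fold iterate of `C` (0-based: coordinates `1,…,n−1`). -/
noncomputable def Vmap (n j : ℕ) (x : Fin n → ℝ) : Fin (n - 1) → ℝ := fun a =>
  (cyc n)^[j] x ⟨(a : ℕ) + 1, by have := a.isLt; omega⟩

/-- `∏_{p<q ∈ S} (X p − X q)`. -/
noncomputable def pairProd (S : Finset ℕ) (X : ℕ → ℝ) : ℝ :=
  ∏ p ∈ S, ∏ q ∈ S, if p < q then X p - X q else 1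

/-- The extension of a tuple `(x₂,…,xₙ)` by `x_{n+1} = 0` and `x_{n+2} = 1`. -/
noncomputable def Xext (n : ℕ) (v : Fin (n - 1) → ℝ) (t : ℕ) : ℝ :=
  if t = n + 1 then 0
  else if t = n + 2 then 1
  else if h2 : 2 ≤ t then if h3 : t ≤ n then v ⟨t - 2, by omega⟩ else 0
  else 0

/-- The function `ε_{n−1}(x₂,…,xₙ) = (1/M)·Σ_{2≤i<j≤n+2, i≤n} (−1)^{j−i}·P_{ij}·
(xᵢ−xⱼ)^{n−1}·log|xᵢ−xⱼ|` with `x_{n+1} = 0`, `x_{n+2} = 1`,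
`M = Π_{2≤p<q≤n+2}(x_p−x_q)` and `P_{ij}` the analogous product over `{2,…,n+2}∖{i,j}`. -/
noncomputable def epsN (n : ℕ) (v : Fin (n - 1) → ℝ) : ℝ :=
  (1 / pairProd (Finset.Icc 2 (n + 2)) (Xext n v)) *
    ∑ i ∈ Finset.Icc 2 n, ∑ j ∈ Finset.Icc (i + 1) (n + 2),
      (-1 : ℝ) ^ (j - i) *
        pairProd (((Finset.Icc 2 (n + 2)).erase i).erase j) (Xext n v) *
        (Xext n v i - Xext n v j) ^ (n - 1) *
        Real.log |Xext n v i - Xext n v j|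

/-- The set `Ω ⊂ ℝⁿ` of tuples with all entries `∉ {0,1}` and pairwise distinct
(a model of the real moduli space `M_{0,n+3}(ℝ)`). -/
def webOmega (n : ℕ) : Set (Fin n → ℝ) :=
  {x | (∀ i, x i ≠ 0 ∧ x i ≠ 1) ∧ ∀ i j, i ≠ j → x i ≠ x j}


open Finset in
lemma aux_lag {ι : Type*} [DecidableEq ι] (T : Finset ι) (s : ι → ℝ) (hs : Set.InjOn s T)
    (hT : 2 ≤ T.card) : ∑ k ∈ T, (∏ l ∈ T.erase k, (s k - s l))⁻¹ = 0 := by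
  have h := Lagrange.coeff_eq_sum (P := (1 : Polynomial ℝ)) hs (by
    rw [Polynomial.degree_one]; exact_mod_cast (by omega : 0 < T.card))
  rw [Polynomial.coeff_one, if_neg (by omega)] at h
  rw [h]
  apply Finset.sum_congr rfl
  intro k _
  simp

lemma pairProd_erase (S : Finset ℕ) (X : ℕ → ℝ) (i : ℕ) (hi : i ∈ S) :
    pairProd S X = pairProd (S.erase i) X * ((-1) ^ (S.filter (· < i)).card *
      ∏ p ∈ S.erase i, (X i - X p)) := by
  unfold pairProd
  have e1 : ∀ p, (∏ q ∈ S, if p < q then X p - X q else 1) =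
      (if p < i then X p - X i else 1) * ∏ q ∈ S.erase i, if p < q then X p - X q else 1 := by
    intro p
    rw [Finset.mul_prod_erase S (fun q => if p < q then X p - X q else 1) hi]
  rw [← Finset.mul_prod_erase S _ hi, e1 i]
  simp_rw [e1]
  rw [Finset.prod_mul_distrib]
  have e2 : (S.filter (· < i)).card = ((S.erase i).filter (· < i)).card := by
    congr 1
    ext t
    simp only [Finset.mem_filter, Finset.mem_erase]
    constructor
    · rintro ⟨a, b⟩; exact ⟨⟨by omega, a⟩, b⟩
    · rintro ⟨⟨_, a⟩, b⟩; exact ⟨a, b⟩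
  rw [e2, ← Finset.prod_const, Finset.prod_filter]
  have e3 : (∏ a ∈ S.erase i, if a < i then (-1 : ℝ) else 1) * ∏ p ∈ S.erase i, (X i - X p) =
      (∏ q ∈ S.erase i, if i < q then X i - X q else 1) *
        ∏ p ∈ S.erase i, (if p < i then X p - X i else 1) := by
    rw [← Finset.prod_mul_distrib, ← Finset.prod_mul_distrib]
    apply Finset.prod_congr rfl
    intro p hp
    have := (Finset.mem_erase.1 hp).1
    rcases lt_or_gt_of_ne this with h | h
    · simp [h, not_lt.2 h.le]
    · simp [h, not_lt.2 h.le]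
  rw [e3]
  simp
  ring

lemma pairProd_two (n : ℕ) (X : ℕ → ℝ) (i j : ℕ) (hi : 2 ≤ i) (hij : i < j) (hj : j ≤ n + 2) :
    pairProd (Finset.Icc 2 (n + 2)) X =
      - ((-1) ^ (j - i) * pairProd (((Finset.Icc 2 (n + 2)).erase i).erase j) X * (X i - X j) *
      ∏ l ∈ ((Finset.Icc 2 (n + 2)).erase i).erase j, ((X i - X l) * (X j - X l))) := by
  have hiS : i ∈ Finset.Icc 2 (n + 2) := Finset.mem_Icc.2 ⟨hi, by omega⟩
  have hjS : j ∈ (Finset.Icc 2 (n + 2)).erase i :=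
    Finset.mem_erase.2 ⟨by omega, Finset.mem_Icc.2 ⟨by omega, by omega⟩⟩
  rw [pairProd_erase _ X i hiS, pairProd_erase _ X j hjS, Finset.prod_mul_distrib,
    ← Finset.mul_prod_erase _ (fun p => X i - X p) hjS]
  have c1 : ((Finset.Icc 2 (n + 2)).filter (· < i)).card = i - 2 := by
    have : (Finset.Icc 2 (n + 2)).filter (· < i) = Finset.Ico 2 i := by
      ext t; simp only [Finset.mem_filter, Finset.mem_Icc, Finset.mem_Ico]; omega
    rw [this, Nat.card_Ico]
  have c2 : (((Finset.Icc 2 (n + 2)).erase i).filter (· < j)).card = j - 3 := by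
    have : ((Finset.Icc 2 (n + 2)).erase i).filter (· < j) = (Finset.Ico 2 j).erase i := by
      ext t
      simp only [Finset.mem_filter, Finset.mem_Icc, Finset.mem_Ico, Finset.mem_erase]; omega
    rw [this, Finset.card_erase_of_mem (Finset.mem_Ico.2 ⟨hi, hij⟩), Nat.card_Ico]
    omega
  rw [c1, c2]
  have hs : (-1 : ℝ) ^ (j - 3) * (-1) ^ (i - 2) = - (-1) ^ (j - i) := by
    obtain ⟨a, rfl⟩ := Nat.exists_eq_add_of_le hi
    obtain ⟨b, rfl⟩ := Nat.exists_eq_add_of_lt hij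
    have h1 : 2 + a + b + 1 - 3 = a + b := by omega
    have h2 : 2 + a - 2 = a := by omega
    have h3 : 2 + a + b + 1 - (2 + a) = b + 1 := by omega
    rw [h1, h2, h3, ← pow_add, show a + b + a = b + 2 * a by ring, pow_add, pow_mul]
    simp [pow_succ]
  linear_combination (pairProd (((Finset.Icc 2 (n + 2)).erase i).erase j) X *
    (∏ p ∈ ((Finset.Icc 2 (n + 2)).erase i).erase j, (X j - X p)) * ((X i - X j) *
    (∏ p ∈ ((Finset.Icc 2 (n + 2)).erase i).erase j, (X i - X p)))) * hs

/-- The symmetric form of (twice) the numerator of Euler's function. -/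
noncomputable def Esum {ι : Type*} [DecidableEq ι] (m : ℕ) (T : Finset ι) (D : ι → ι → ℝ) : ℝ :=
  ∑ i ∈ T, ∑ k ∈ T, D i k ^ m * Real.log |D i k| /
    ∏ l ∈ T, if l = i ∨ l = k then 1 else D i l * D k l

lemma Esum_image {ι κ : Type*} [DecidableEq ι] [DecidableEq κ] (m : ℕ) (S : Finset κ)
    (φ : κ → ι) (hφ : Set.InjOn φ S) (D : ι → ι → ℝ) :
    Esum m (S.image φ) D = Esum m S (fun a b => D (φ a) (φ b)) := by
  unfold Esum
  rw [Finset.sum_image hφ]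
  apply Finset.sum_congr rfl; intro i hi
  rw [Finset.sum_image hφ]
  apply Finset.sum_congr rfl; intro k hk
  rw [Finset.prod_image hφ]
  congr 1
  apply Finset.prod_congr rfl; intro l hl
  simp only [hφ.eq_iff hl hi, hφ.eq_iff hl hk]

lemma Esum_congr {ι : Type*} [DecidableEq ι] (m : ℕ) (T : Finset ι) (D D' : ι → ι → ℝ)
    (h : ∀ i ∈ T, ∀ k ∈ T, D i k = D' i k) : Esum m T D = Esum m T D' := by
  unfold Esum
  apply Finset.sum_congr rfl; intro i hi
  apply Finset.sum_congr rfl; intro k hk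
  rw [h i hi k hk]
  congr 1
  apply Finset.prod_congr rfl; intro l hl
  rw [h i hi l hl, h k hk l hl]

lemma prod_erase_erase {ι : Type*} [DecidableEq ι] (T : Finset ι) (i k : ι) (f : ι → ℝ) :
    (∏ l ∈ T, if l = i ∨ l = k then 1 else f l) = ∏ l ∈ (T.erase i).erase k, f l := by
  have : (T.erase i).erase k = T.filter (fun l => ¬ (l = i ∨ l = k)) := by
    ext t; simp only [Finset.mem_erase, Finset.mem_filter]; tauto
  rw [this, Finset.prod_filter]
  apply Finset.prod_congr rfl; intro l _
  by_cases h : l = i ∨ l = k <;> simp [h]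

lemma sum_sym (n : ℕ) (f : ℕ → ℕ → ℝ) (h0 : ∀ i, f i i = 0) (hs : ∀ i j, f i j = f j i)
    (hl : f (n + 1) (n + 2) = 0) :
    2 * ∑ i ∈ Finset.Icc 2 n, ∑ j ∈ Finset.Icc (i + 1) (n + 2), f i j =
      ∑ i ∈ Finset.Icc 2 (n + 2), ∑ j ∈ Finset.Icc 2 (n + 2), f i j := by
  have e1 : ∑ i ∈ Finset.Icc 2 n, ∑ j ∈ Finset.Icc (i + 1) (n + 2), f i j =
      ∑ i ∈ Finset.Icc 2 (n + 2), ∑ j ∈ Finset.Icc 2 (n + 2), if i < j then f i j else 0 := by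
    have : ∀ i ∈ Finset.Icc 2 (n + 2),
        (∑ j ∈ Finset.Icc 2 (n + 2), if i < j then f i j else 0) =
        ∑ j ∈ Finset.Icc (i + 1) (n + 2), f i j := by
      intro i hi
      rw [Finset.mem_Icc] at hi
      rw [← Finset.sum_filter]
      congr 1
      ext t; simp only [Finset.mem_filter, Finset.mem_Icc]; omega
    rw [Finset.sum_congr rfl this]
    apply Finset.sum_subset
    · intro t; simp only [Finset.mem_Icc]; omega
    · intro t h1 h2
      simp only [Finset.mem_Icc] at h1 h2
      apply Finset.sum_eq_zero
      intro j hj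
      rw [Finset.mem_Icc] at hj
      have a1 : t = n + 1 := by omega
      have a2 : j = n + 2 := by omega
      rw [a1, a2, hl]
  have e2 : ∑ i ∈ Finset.Icc 2 n, ∑ j ∈ Finset.Icc (i + 1) (n + 2), f i j =
      ∑ i ∈ Finset.Icc 2 (n + 2), ∑ j ∈ Finset.Icc 2 (n + 2), if j < i then f i j else 0 := by
    rw [e1, Finset.sum_comm]
    apply Finset.sum_congr rfl; intro i _
    apply Finset.sum_congr rfl; intro j _
    rw [hs]
  rw [two_mul]
  nth_rewrite 1 [e1]
  rw [e2, ← Finset.sum_add_distrib]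
  apply Finset.sum_congr rfl; intro i _
  rw [← Finset.sum_add_distrib]
  apply Finset.sum_congr rfl; intro j _
  rcases lt_trichotomy i j with h | h | h
  · simp [h, not_lt.2 h.le]
  · subst h; simp [h0]
  · simp [h, not_lt.2 h.le]

lemma pairProd_ne (S : Finset ℕ) (X : ℕ → ℝ) (h : Set.InjOn X S) : pairProd S X ≠ 0 := by
  unfold pairProd
  refine Finset.prod_ne_zero_iff.2 fun p hp => Finset.prod_ne_zero_iff.2 fun q hq => ?_
  split_ifs with hpq
  · intro h0
    exact hpq.ne (h hp hq (sub_eq_zero.1 h0))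
  · exact one_ne_zero

lemma eps_eq (n : ℕ) (hn : 2 ≤ n) (hne : Even n) (v : Fin (n - 1) → ℝ)
    (h : Set.InjOn (Xext n v) (Finset.Icc 2 (n + 2))) :
    epsN n v = -(1 / 2) * Esum (n - 2) (Finset.Icc 2 (n + 2))
      (fun a b => Xext n v a - Xext n v b) := by
  unfold epsN Esum
  set X := Xext n v with hX
  have hm : Even (n - 2) := (Nat.even_sub hn).2 (by simp [hne])
  rw [← sum_sym n (fun a b => (X a - X b) ^ (n - 2) * Real.log |X a - X b| /
    ∏ l ∈ Finset.Icc 2 (n + 2), if l = a ∨ l = b then 1 else (X a - X l) * (X b - X l))]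
  · rw [← mul_assoc, Finset.mul_sum, Finset.mul_sum]
    apply Finset.sum_congr rfl; intro i hi
    rw [Finset.mul_sum, Finset.mul_sum]
    apply Finset.sum_congr rfl; intro j hj
    rw [Finset.mem_Icc] at hi hj
    have hM := pairProd_ne _ _ h
    rw [pairProd_two n X i j (by omega) (by omega) (by omega)] at hM ⊢
    rw [prod_erase_erase]
    have hM2 := neg_ne_zero.1 hM
    simp only [mul_ne_zero_iff] at hM2
    obtain ⟨⟨⟨a1, a2⟩, a3⟩, a4⟩ := hM2
    have : n - 1 = (n - 2) + 1 := by omega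
    rw [this, pow_succ]
    field_simp
  · intro i; simp
  · intro i j
    congr 1
    · rw [abs_sub_comm, ← neg_sub (X j) (X i), hm.neg_pow]
    · apply Finset.prod_congr rfl; intro l _
      by_cases hh : l = i ∨ l = j
      · rw [if_pos hh, if_pos hh.symm]
      · rw [if_neg hh, if_neg (fun h => hh h.symm), mul_comm]
  · have h1 : X (n + 1) = 0 := by simp [hX, Xext]
    have h2 : X (n + 2) = 1 := by simp [hX, Xext]
    simp [h1, h2]

lemma hlag {ι : Type*} [Fintype ι] [DecidableEq ι] (n : ℕ) (hn : 2 ≤ n)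
    (hc : Fintype.card ι = n + 3) (X Y : ι → ℝ) (b : ι → ι → ℝ)
    (hb : ∀ s t, b s t = X s * Y t - X t * Y s) (hb0 : ∀ s t, s ≠ t → b s t ≠ 0) (j i : ι)
    (hij : i ≠ j) :
    ∑ k ∈ (Finset.univ.erase j).erase i, b i k ^ (n - 2) /
      ∏ l ∈ ((Finset.univ.erase j).erase i).erase k, (b i l * b k l) = 0 := by
  set U := (Finset.univ.erase j).erase i with hU
  have hUc : U.card = n + 1 := by
    rw [hU, Finset.card_erase_of_mem (by simp [hij]), Finset.card_erase_of_mem (by simp),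
      Finset.card_univ, hc]
    rfl
  have hUm : ∀ k ∈ U, i ≠ k ∧ k ≠ j := by
    intro k hk; simp [hU] at hk; exact ⟨fun h => hk.1 h.symm, hk.2⟩
  set s : ι → ℝ := fun k => b k j / b i k with hs
  have hd : ∀ k ∈ U, ∀ l ∈ U, b k l = (s k - s l) * (b i k * b i l / b i j) := by
    intro k hk l hl
    have h1 := hb0 i k (hUm k hk).1
    have h2 := hb0 i l (hUm l hl).1
    have h3 := hb0 i j hij
    rw [hs]
    field_simp
    simp only [hb]
    ring
  have hinj : Set.InjOn s U := by
    intro k hk l hl h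
    by_contra hkl
    apply hb0 k l hkl
    rw [hd k hk l hl, h, sub_self, zero_mul]
  have hL := aux_lag U s hinj (by omega)
  set P := ∏ l ∈ U, b i l with hP
  have hP0 : P ≠ 0 := Finset.prod_ne_zero_iff.2 fun l hl => hb0 i l (hUm l hl).1
  have h3 := hb0 i j hij
  rw [show (0 : ℝ) = b i j ^ n / P ^ 2 * 0 by ring, ← hL, Finset.mul_sum]
  apply Finset.sum_congr rfl
  intro k hk
  have h1 := hb0 i k (hUm k hk).1
  have e1 : ∏ l ∈ U.erase k, (b i l * b k l) =
      (∏ l ∈ U.erase k, b i l) ^ 2 * (b i k / b i j) ^ n * ∏ l ∈ U.erase k, (s k - s l) := by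
    have : (U.erase k).card = n := by rw [Finset.card_erase_of_mem hk, hUc]; rfl
    rw [← this, ← Finset.prod_const, ← Finset.prod_pow, ← Finset.prod_mul_distrib,
      ← Finset.prod_mul_distrib]
    apply Finset.prod_congr rfl
    intro l hl
    rw [hd k hk l (Finset.mem_erase.1 hl).2]
    ring
  have e2 : P = b i k * ∏ l ∈ U.erase k, b i l := (Finset.mul_prod_erase U _ hk).symm
  have h4 : ∏ l ∈ U.erase k, b i l ≠ 0 := by
    intro h; rw [h, mul_zero] at e2; exact hP0 e2
  have h5 : ∏ l ∈ U.erase k, (s k - s l) ≠ 0 := by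
    refine Finset.prod_ne_zero_iff.2 fun l hl => sub_ne_zero.2 fun h => ?_
    exact (Finset.mem_erase.1 hl).1 (hinj (Finset.mem_erase.1 hl).2 hk h.symm)
  rw [e1, e2]
  obtain ⟨m, rfl⟩ := Nat.exists_eq_add_of_le hn
  rw [show 2 + m - 2 = m by omega, div_pow, pow_add (b i k)]
  field_simp

lemma Esum_scale {ι : Type*} [Fintype ι] [DecidableEq ι] (n : ℕ) (hn : 2 ≤ n) (hne : Even n)
    (hc : Fintype.card ι = n + 3) (X Y : ι → ℝ) (b : ι → ι → ℝ)
    (hb : ∀ s t, b s t = X s * Y t - X t * Y s) (hb0 : ∀ s t, s ≠ t → b s t ≠ 0) (j : ι)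
    (κ : ℝ) (μ : ι → ℝ) (hκ : κ ≠ 0) (hμ : ∀ t, t ≠ j → μ t ≠ 0) :
    Esum (n - 2) (Finset.univ.erase j) (fun s t => κ * μ s * μ t * b s t) =
      (κ ^ (n + 2) * (∏ t ∈ Finset.univ.erase j, μ t) ^ 2)⁻¹ *
        Esum (n - 2) (Finset.univ.erase j) b := by
  have hm : Even (n - 2) := (Nat.even_sub hn).2 (by simp [hne])
  set T := Finset.univ.erase j with hT
  have hTc : T.card = n + 2 := by
    rw [hT, Finset.card_erase_of_mem (by simp), Finset.card_univ, hc]; rfl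
  have hTm : ∀ t ∈ T, t ≠ j := fun t ht => (Finset.mem_erase.1 ht).1
  have hbn : ∀ s t, b s t = - b t s := by intro s t; rw [hb, hb]; ring
  have hbz : ∀ s, b s s = 0 := by intro s; rw [hb]; ring
  set R : ι → ι → ℝ := fun i k => if i = k then 0 else b i k ^ (n - 2) /
      ∏ l ∈ (T.erase i).erase k, (b i l * b k l) with hR
  have hRs : ∀ i k, R i k = R k i := by
    intro i k
    simp only [hR]
    by_cases h : i = k
    · simp [h]
    · rw [if_neg h, if_neg (Ne.symm h), hbn i k, hm.neg_pow, Finset.erase_right_comm]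
      congr 1
      apply Finset.prod_congr rfl; intro l _; ring
  have hR0 : ∀ i ∈ T, ∑ k ∈ T, R i k = 0 := by
    intro i hi
    rw [← Finset.add_sum_erase T _ hi]
    have : R i i = 0 := by simp [hR]
    rw [this, zero_add, ← hlag n hn hc X Y b hb hb0 j i (hTm i hi)]
    apply Finset.sum_congr rfl
    intro k hk
    simp only [hR]
    rw [if_neg (Ne.symm (Finset.mem_erase.1 hk).1)]
  have hR1 : ∀ k ∈ T, ∑ i ∈ T, R i k = 0 := by
    intro k hk
    rw [← hR0 k hk]
    exact Finset.sum_congr rfl fun i _ => hRs i k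
  have hE : Esum (n - 2) T b = ∑ i ∈ T, ∑ k ∈ T, R i k * Real.log |b i k| := by
    unfold Esum
    apply Finset.sum_congr rfl; intro i hi
    apply Finset.sum_congr rfl; intro k hk
    rw [prod_erase_erase]
    by_cases h : i = k
    · subst h; simp [hbz]
    · simp only [hR]; rw [if_neg h]; ring
  set Pm := ∏ t ∈ T, μ t with hPm
  have hPm0 : Pm ≠ 0 := Finset.prod_ne_zero_iff.2 fun t ht => hμ t (hTm t ht)
  have hE2 : Esum (n - 2) T (fun s t => κ * μ s * μ t * b s t) =
      (κ ^ (n + 2) * Pm ^ 2)⁻¹ * ∑ i ∈ T, ∑ k ∈ T,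
        R i k * (Real.log |κ| + Real.log |μ i| + Real.log |μ k| + Real.log |b i k|) := by
    unfold Esum
    rw [Finset.mul_sum]
    apply Finset.sum_congr rfl; intro i hi
    rw [Finset.mul_sum]
    apply Finset.sum_congr rfl; intro k hk
    rw [prod_erase_erase]
    by_cases h : i = k
    · subst h; simp [hbz, hR]
    · have hk' : k ∈ T.erase i := Finset.mem_erase.2 ⟨Ne.symm h, hk⟩
      have h1 := hμ i (hTm i hi)
      have h2 := hμ k (hTm k hk)
      have h3 := hb0 i k h
      have e1 : ∏ l ∈ (T.erase i).erase k, (κ * μ i * μ l * b i l * (κ * μ k * μ l * b k l)) =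
          (κ ^ 2 * μ i * μ k) ^ n * (∏ l ∈ (T.erase i).erase k, μ l) ^ 2 *
            ∏ l ∈ (T.erase i).erase k, (b i l * b k l) := by
        have : ((T.erase i).erase k).card = n := by
          rw [Finset.card_erase_of_mem hk', Finset.card_erase_of_mem hi, hTc]; rfl
        nth_rewrite 1 [← this]
        rw [← Finset.prod_const, ← Finset.prod_pow, ← Finset.prod_mul_distrib,
          ← Finset.prod_mul_distrib]
        apply Finset.prod_congr rfl
        intro l hl
        ring
      have e2 : Pm = μ i * (μ k * ∏ l ∈ (T.erase i).erase k, μ l) := by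
        rw [Finset.mul_prod_erase _ _ hk', Finset.mul_prod_erase _ _ hi]
      have h4 : ∏ l ∈ (T.erase i).erase k, μ l ≠ 0 := by
        intro h; rw [h] at e2; simp at e2; exact hPm0 e2
      have h5 : ∏ l ∈ (T.erase i).erase k, (b i l * b k l) ≠ 0 := by
        refine Finset.prod_ne_zero_iff.2 fun l hl => ?_
        simp only [Finset.mem_erase] at hl
        exact mul_ne_zero (hb0 _ _ (Ne.symm hl.2.1)) (hb0 _ _ (Ne.symm hl.1))
      simp only [hR]
      rw [if_neg h, e1, e2, abs_mul, abs_mul, abs_mul, Real.log_mul, Real.log_mul, Real.log_mul]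
      rotate_left
      iterate 6 positivity
      generalize Real.log |κ| + Real.log |μ i| + Real.log |μ k| + Real.log |b i k| = L
      obtain ⟨m, rfl⟩ := Nat.exists_eq_add_of_le hn
      rw [show 2 + m - 2 = m by omega]
      simp only [mul_pow, ← pow_mul]
      field_simp
      ring
  rw [hE2, hE]
  congr 1
  have : ∀ i ∈ T, ∑ k ∈ T,
        R i k * (Real.log |κ| + Real.log |μ i| + Real.log |μ k| + Real.log |b i k|) =
      (∑ k ∈ T, R i k) * (Real.log |κ| + Real.log |μ i|) + (∑ k ∈ T, R i k * Real.log |μ k|)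
       + ∑ k ∈ T, R i k * Real.log |b i k| := by
    intro i _
    rw [Finset.sum_mul, ← Finset.sum_add_distrib, ← Finset.sum_add_distrib]
    apply Finset.sum_congr rfl; intro k _; ring
  rw [Finset.sum_congr rfl this, Finset.sum_add_distrib, Finset.sum_add_distrib]
  rw [Finset.sum_eq_zero (fun i hi => by rw [hR0 i hi, zero_mul]), Finset.sum_comm (s := T)]
  rw [Finset.sum_eq_zero (s := T) (f := fun y => ∑ x ∈ T, R x y * Real.log |μ y|)
    (fun i hi => by rw [← Finset.sum_mul, hR1 i hi, zero_mul])]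
  ring

lemma Esum_quad {ι : Type*} [Fintype ι] [DecidableEq ι] (m : ℕ) (b : ι → ι → ℝ)
    (hbz : ∀ s, b s s = 0) (hb0 : ∀ s t, s ≠ t → b s t ≠ 0) (j : ι) :
    Esum m (Finset.univ.erase j) b = ∑ i, ∑ k, (b i k ^ m * Real.log |b i k| /
      ∏ l, if l = i ∨ l = k then 1 else b i l * b k l) * (b i j * b k j) := by
  unfold Esum
  rw [← Finset.add_sum_erase Finset.univ _ (Finset.mem_univ j)]
  rw [Finset.sum_eq_zero (s := Finset.univ) (fun k _ => by rw [hbz j]; ring), zero_add]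
  apply Finset.sum_congr rfl; intro i hi
  rw [← Finset.add_sum_erase Finset.univ _ (Finset.mem_univ j), hbz j, mul_zero, mul_zero, zero_add]
  apply Finset.sum_congr rfl; intro k hk
  have h1 := (Finset.mem_erase.1 hi).1
  have h2 := (Finset.mem_erase.1 hk).1
  rw [← Finset.mul_prod_erase Finset.univ _ (Finset.mem_univ j), if_neg (by tauto)]
  have := hb0 i j h1
  have := hb0 k j h2
  field_simp

/-- First homogeneous coordinate of the `t`-th point of `(x₁,…,xₙ,0,1,∞)`. -/
noncomputable def UX (n : ℕ) (x : Fin n → ℝ) (t : ZMod (n + 3)) : ℝ :=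
  if h : t.val < n then x ⟨t.val, h⟩ else if t.val = n then 0 else 1

/-- Second homogeneous coordinate of the `t`-th point of `(x₁,…,xₙ,0,1,∞)`. -/
noncomputable def UY (n : ℕ) (t : ZMod (n + 3)) : ℝ := if t.val = n + 2 then 0 else 1

/-- Brackets. -/
noncomputable def br (n : ℕ) (x : Fin n → ℝ) (s t : ZMod (n + 3)) : ℝ :=
  UX n x s * UY n t - UX n x t * UY n s

/-- Cross ratios. -/
noncomputable def cr (n : ℕ) (x : Fin n → ℝ) (j p : ZMod (n + 3)) : ℝ :=
  br n x p (j - 3) * br n x (j - 2) (j - 1) / (br n x p (j - 1) * br n x (j - 2) (j - 3))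

lemma br_ne (n : ℕ) (x : Fin n → ℝ) (hx : x ∈ webOmega n) (s t : ZMod (n + 3)) (hst : s ≠ t) :
    br n x s t ≠ 0 := by
  have hv : s.val ≠ t.val := fun h => hst (ZMod.val_injective _ h)
  have h1 := ZMod.val_lt s
  have h2 := ZMod.val_lt t
  obtain ⟨hx1, hx2⟩ := hx
  unfold br UX UY
  generalize s.val = a at *
  generalize t.val = c at *
  rcases lt_or_ge a n with ha | ha
  · rcases lt_or_ge c n with hc | hc
    · have h3 : a ≠ n + 2 := by omega
      have h4 : c ≠ n + 2 := by omega
      have := hx2 ⟨a, ha⟩ ⟨c, hc⟩ (by simpa using hv)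
      simp [ha, hc, h3, h4, sub_ne_zero, this]
    · have h3 : a ≠ n + 2 := by omega
      have h4 := hx1 ⟨a, ha⟩
      obtain rfl | rfl | rfl : c = n ∨ c = n + 1 ∨ c = n + 2 := by omega
      · simp [ha, h3, h4]
      · simp [ha, h3, h4, sub_ne_zero]
      · simp [ha, h3]
  · rcases lt_or_ge c n with hc | hc
    · have h3 : c ≠ n + 2 := by omega
      have h4 := hx1 ⟨c, hc⟩
      obtain rfl | rfl | rfl : a = n ∨ a = n + 1 ∨ a = n + 2 := by omega
      · simp [hc, h3, h4]
      · simp [hc, h3, sub_ne_zero, Ne.symm h4.2]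
      · simp [hc, h3]
    · have hA : a = n ∨ a = n + 1 ∨ a = n + 2 := by omega
      have hC : c = n ∨ c = n + 1 ∨ c = n + 2 := by omega
      rcases hA with h | h | h <;> rcases hC with h' | h' | h' <;> simp [h, h'] at hv ⊢

lemma cast_ne (n a c : ℕ) (ha : a < n + 3) (hc : c < n + 3) (h : a ≠ c) :
    (a : ZMod (n + 3)) ≠ (c : ZMod (n + 3)) := by
  intro hh
  apply h
  have := congrArg ZMod.val hh
  rwa [ZMod.val_natCast_of_lt ha, ZMod.val_natCast_of_lt hc] at this

lemma cast_n (n : ℕ) : (n : ZMod (n + 3)) = -3 := by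
  have : ((n + 3 : ℕ) : ZMod (n + 3)) = 0 := ZMod.natCast_self _
  push_cast at this
  linear_combination this

lemma cr_zero (n : ℕ) (x : Fin n → ℝ) (i : Fin n) :
    cr n x 0 ((i : ℕ) : ZMod (n + 3)) = x i := by
  have e3 : (0 - 3 : ZMod (n + 3)) = ((n : ℕ) : ZMod (n + 3)) := by rw [cast_n]; ring
  have e2 : (0 - 2 : ZMod (n + 3)) = ((n + 1 : ℕ) : ZMod (n + 3)) := by
    push_cast; rw [cast_n]; ring
  have e1 : (0 - 1 : ZMod (n + 3)) = ((n + 2 : ℕ) : ZMod (n + 3)) := by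
    push_cast; rw [cast_n]; ring
  have hi := i.isLt
  have h2 : (i : ℕ) ≠ n + 2 := by omega
  unfold cr br UX UY
  rw [e3, e2, e1, ZMod.val_natCast_of_lt (by omega), ZMod.val_natCast_of_lt (by omega),
    ZMod.val_natCast_of_lt (by omega), ZMod.val_natCast_of_lt (by omega)]
  simp [h2]

lemma zne (n : ℕ) (j : ZMod (n + 3)) (a c : ℕ) (ha : a < n + 3) (hc : c < n + 3) (h : a ≠ c) :
    j + a ≠ j + c := fun hh => cast_ne n a c ha hc h (add_left_cancel hh)

lemma cr_sub (n : ℕ) (x : Fin n → ℝ) (hx : x ∈ webOmega n) (j p q : ZMod (n + 3))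
    (hp : p ≠ j - 1) (hq : q ≠ j - 1) : cr n x j p - cr n x j q =
      (br n x (j - 2) (j - 1) * br n x (j - 3) (j - 1) / br n x (j - 2) (j - 3)) *
        (1 / br n x p (j - 1)) * (1 / br n x q (j - 1)) * br n x p q := by
  have h1 := br_ne n x hx _ _ hp
  have h2 := br_ne n x hx _ _ hq
  have h3 : br n x (j - 2) (j - 3) ≠ 0 := br_ne n x hx _ _ (by
    have := zne n (j - 3) 1 0 (by omega) (by omega) (by omega)
    intro h; apply this; push_cast; linear_combination h)
  unfold cr
  field_simp
  unfold br
  ring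

lemma jne (n : ℕ) (j : ZMod (n + 3)) : j - 2 ≠ j - 3 ∧ j - 2 ≠ j - 1 ∧ j - 3 ≠ j - 1 ∧ j ≠ j - 1
    ∧ j ≠ j - 2 ∧ (0 < n → j ≠ j - 3) := by
  refine ⟨?_, ?_, ?_, ?_, ?_, ?_⟩
  · have := zne n (j - 3) 1 0 (by omega) (by omega) (by omega)
    intro h; apply this; push_cast; linear_combination h
  · have := zne n (j - 3) 1 2 (by omega) (by omega) (by omega)
    intro h; apply this; push_cast; linear_combination h
  · have := zne n (j - 3) 0 2 (by omega) (by omega) (by omega)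
    intro h; apply this; push_cast; linear_combination h
  · have := zne n (j - 1) 1 0 (by omega) (by omega) (by omega)
    intro h; apply this; push_cast; linear_combination h
  · have := zne n (j - 2) 2 0 (by omega) (by omega) (by omega)
    intro h; apply this; push_cast; linear_combination h
  · intro h0
    have := zne n (j - 3) 3 0 (by omega) (by omega) (by omega)
    intro h; apply this; push_cast; linear_combination h

lemma cr_N0 (n : ℕ) (x : Fin n → ℝ) (j : ZMod (n + 3)) : cr n x j (j - 3) = 0 := by
  have : br n x (j - 3) (j - 3) = 0 := by unfold br; ring
  unfold cr; rw [this]; simp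

lemma cr_N1 (n : ℕ) (x : Fin n → ℝ) (hx : x ∈ webOmega n) (j : ZMod (n + 3)) :
    cr n x j (j - 2) = 1 := by
  have h1 := br_ne n x hx _ _ (jne n j).1
  have h2 := br_ne n x hx _ _ (jne n j).2.1
  unfold cr; field_simp

lemma cyc_iter (n : ℕ) (x : Fin n → ℝ) (hx : x ∈ webOmega n) (j : ℕ) (i : Fin n) :
    (cyc n)^[j] x i = cr n x j (j + (i : ℕ)) := by
  induction j generalizing i with
  | zero => simp [cr_zero]
  | succ j ih =>
    have hi := i.isLt
    rw [Function.iterate_succ_apply', cyc]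
    set J : ZMod (n + 3) := (j : ZMod (n + 3)) with hJ
    obtain ⟨a1, a2, a3, a4, a5, a6⟩ := jne n J
    have b1 := br_ne n x hx _ _ a1
    have b2 := br_ne n x hx _ _ a2
    have b3 := br_ne n x hx _ _ a3
    have b4 := br_ne n x hx _ _ a4
    have b5 := br_ne n x hx _ _ a5
    have b6 := br_ne n x hx _ _ (a6 (by omega))
    have b7 := br_ne n x hx _ _ (Ne.symm a2)
    have f1 : ((j + 1 : ℕ) : ZMod (n + 3)) = J + 1 := by push_cast; rfl
    have g1 : J + 1 - 1 = J := by ring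
    have g2 : J + 1 - 2 = J - 1 := by ring
    have g3 : J + 1 - 3 = J - 2 := by ring
    rw [f1]
    split_ifs with h
    · rw [ih, ih]
      simp only [Nat.cast_zero, add_zero, Nat.cast_add, Nat.cast_one]
      have e : J + 1 + ((i : ℕ) : ZMod (n + 3)) = J + (((i : ℕ) : ZMod (n + 3)) + 1) := by ring
      rw [e]
      have c1 : J + (((i : ℕ) : ZMod (n + 3)) + 1) ≠ J - 1 := by
        have := zne n J (i + 1) (n + 2) (by omega) (by omega) (by omega)
        intro hh; apply this; push_cast; rw [cast_n, hh]; ring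
      have c2 : J ≠ J + (((i : ℕ) : ZMod (n + 3)) + 1) := by
        have := zne n J 0 (i + 1) (by omega) (by omega) (by omega)
        intro hh; apply this; push_cast; rw [← hh]; ring
      have d1 := br_ne n x hx _ _ c1
      have d2 := br_ne n x hx _ _ c2
      have d3 := br_ne n x hx _ _ (Ne.symm c2)
      rw [cr_sub n x hx J _ _ a4 c1]
      nth_rewrite 1 [← cr_N1 n x hx J]
      rw [cr_sub n x hx J _ _ a2 c1]
      unfold cr
      rw [g1, g2, g3]
      generalize J + (((i : ℕ) : ZMod (n + 3)) + 1) = q at *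
      rw [show br n x (J - 2) q = - br n x q (J - 2) by unfold br; ring,
        show br n x (J - 1) (J - 2) = - br n x (J - 2) (J - 1) by unfold br; ring,
        show br n x (J - 1) J = - br n x J (J - 1) by unfold br; ring,
        show br n x q J = - br n x J q by unfold br; ring]
      field_simp
    · rw [ih]
      simp only [Nat.cast_zero, add_zero]
      have hin : (i : ℕ) = n - 1 := by omega
      have e : J + 1 + ((i : ℕ) : ZMod (n + 3)) = J - 3 := by
        have : ((i + 1 : ℕ) : ZMod (n + 3)) = -3 := by
          rw [hin, Nat.sub_add_cancel (by omega), cast_n]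
        push_cast at this
        linear_combination this
      rw [e]
      unfold cr
      rw [g1, g2, g3, 
        show br n x (J - 1) (J - 2) = - br n x (J - 2) (J - 1) by unfold br; ring,
        show br n x (J - 1) J = - br n x J (J - 1) by unfold br; ring,
        show br n x (J - 3) J = - br n x J (J - 3) by unfold br; ring,
        show br n x (J - 3) (J - 2) = - br n x (J - 2) (J - 3) by unfold br; ring]
      field_simp

lemma cr_inj (n : ℕ) (x : Fin n → ℝ) (hx : x ∈ webOmega n) (j p q : ZMod (n + 3))
    (hp : p ≠ j - 1) (hq : q ≠ j - 1) (hpq : p ≠ q) : cr n x j p ≠ cr n x j q := by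
  rw [← sub_ne_zero, cr_sub n x hx j p q hp hq]
  obtain ⟨a1, a2, a3, a4, a5, a6⟩ := jne n j
  have b1 := br_ne n x hx _ _ a1
  have b2 := br_ne n x hx _ _ a2
  have b3 := br_ne n x hx _ _ a3
  have b4 := br_ne n x hx _ _ hp
  have b5 := br_ne n x hx _ _ hq
  have b6 := br_ne n x hx _ _ hpq
  positivity

lemma cyc_mapsTo (n : ℕ) : Set.MapsTo (cyc n) (webOmega n) (webOmega n) := by
  intro x hx
  have h : ∀ i : Fin n, cyc n x i = cr n x 1 (1 + (i : ℕ)) := by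
    intro i; have := cyc_iter n x hx 1 i; simpa using this
  have hm : ∀ i : Fin n, ∀ s : ℕ, s < 3 → (1 + ((i : ℕ) : ZMod (n + 3)) ≠ 1 - 3 + s) := by
    intro i s hs
    have hi := i.isLt
    have := zne n 1 i (n + s) (by omega) (by omega) (by omega)
    intro hh; apply this; push_cast; rw [cast_n, hh]; ring
  have h0 : ∀ i : Fin n, 1 + ((i : ℕ) : ZMod (n + 3)) ≠ 1 - 3 := by
    intro i; simpa using hm i 0 (by omega)
  have h1 : ∀ i : Fin n, 1 + ((i : ℕ) : ZMod (n + 3)) ≠ 1 - 2 := by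
    intro i hh; exact hm i 1 (by omega) (by rw [hh]; push_cast; ring)
  have h2 : ∀ i : Fin n, 1 + ((i : ℕ) : ZMod (n + 3)) ≠ 1 - 1 := by
    intro i hh; exact hm i 2 (by omega) (by rw [hh]; push_cast; ring)
  obtain ⟨a1, a2, a3, a4, a5, a6⟩ := jne n 1
  refine ⟨fun i => ⟨?_, ?_⟩, fun i k hik => ?_⟩
  · rw [h, ← cr_N0 n x 1]
    exact cr_inj n x hx _ _ _ (h2 i) a3 (h0 i)
  · rw [h, ← cr_N1 n x hx 1]
    exact cr_inj n x hx _ _ _ (h2 i) a2 (h1 i)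
  · rw [h, h]
    refine cr_inj n x hx _ _ _ (h2 i) (h2 k) ?_
    exact zne n 1 i k (by omega) (by omega) (fun h => hik (Fin.ext h))

lemma Esum_inf {ι : Type*} [DecidableEq ι] (m : ℕ) (T : Finset ι) (D : ι → ι → ℝ) (o : ι)
    (ho : o ∈ T) (h1 : ∀ i ∈ T, i ≠ o → D i o = -1) (h2 : ∀ i ∈ T, i ≠ o → D o i = 1)
    (h3 : D o o = 0) : Esum m (T.erase o) D = Esum m T D := by
  unfold Esum
  rw [← Finset.add_sum_erase T _ ho]
  rw [Finset.sum_eq_zero (s := T) (fun k hk => by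
    by_cases h : k = o
    · rw [h, h3]; simp
    · rw [h2 k hk h]; simp), zero_add]
  apply Finset.sum_congr rfl; intro i hi
  obtain ⟨hi1, hi2⟩ := Finset.mem_erase.1 hi
  rw [← Finset.add_sum_erase T _ ho, h1 i hi2 hi1]
  simp only [abs_neg, abs_one, Real.log_one, mul_zero, zero_div, zero_add]
  apply Finset.sum_congr rfl; intro k hk
  obtain ⟨hk1, hk2⟩ := Finset.mem_erase.1 hk
  congr 1
  rw [← Finset.mul_prod_erase T _ ho, if_neg (by tauto), h1 i hi2 hi1, h1 k hk2 hk1]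
  ring

lemma Xext_V (n : ℕ) (x : Fin n → ℝ) (hx : x ∈ webOmega n) (j t : ℕ)
    (ht : t ∈ Finset.Icc 2 (n + 2)) :
    Xext n (Vmap n j x) t = cr n x j (j - 1 + (t : ZMod (n + 3))) := by
  rw [Finset.mem_Icc] at ht
  unfold Xext
  split_ifs with h1 h2 h3 h4
  · rw [h1]
    push_cast
    rw [cast_n, ← cr_N0 n x j]
    congr 1; ring
  · rw [h2]
    push_cast
    rw [cast_n, ← cr_N1 n x hx j]
    congr 1; ring
  · unfold Vmap
    rw [cyc_iter n x hx]
    congr 1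
    dsimp only
    rw [show t - 2 + 1 = t - 1 by omega, Nat.cast_sub (by omega)]
    push_cast; ring
  · omega
  · omega

/-- The scale constant. -/
noncomputable def Kc (n : ℕ) (x : Fin n → ℝ) (j : ZMod (n + 3)) : ℝ :=
  br n x (j - 2) (j - 1) * br n x (j - 3) (j - 1) / br n x (j - 2) (j - 3)

/-- The scale factors. -/
noncomputable def muc (n : ℕ) (x : Fin n → ℝ) (j t : ZMod (n + 3)) : ℝ :=
  if t = j - 1 then -1 / Kc n x j else 1 / br n x t (j - 1)

lemma Kc_ne (n : ℕ) (x : Fin n → ℝ) (hx : x ∈ webOmega n) (j : ZMod (n + 3)) : Kc n x j ≠ 0 := by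
  obtain ⟨a1, a2, a3, a4, a5, a6⟩ := jne n j
  have b1 := br_ne n x hx _ _ a1
  have b2 := br_ne n x hx _ _ a2
  have b3 := br_ne n x hx _ _ a3
  unfold Kc
  positivity

lemma muc_ne (n : ℕ) (x : Fin n → ℝ) (hx : x ∈ webOmega n) (j t : ZMod (n + 3)) :
    muc n x j t ≠ 0 := by
  have b1 := Kc_ne n x hx j
  unfold muc
  split_ifs with h
  · exact div_ne_zero (by norm_num) b1
  · exact one_div_ne_zero (br_ne n x hx _ _ h)

lemma img_phi (n : ℕ) (j : ZMod (n + 3)) :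
    (Finset.Icc 2 (n + 2)).image (fun t : ℕ => j - 1 + (t : ZMod (n + 3))) =
      (Finset.univ.erase j).erase (j - 1) := by
  ext p
  simp only [Finset.mem_image, Finset.mem_Icc, Finset.mem_erase, Finset.mem_univ, and_true]
  constructor
  · rintro ⟨t, ⟨h1, h2⟩, rfl⟩
    constructor
    · have := zne n (j - 1) t 0 (by omega) (by omega) (by omega)
      simpa using this
    · have := zne n (j - 1) t 1 (by omega) (by omega) (by omega)
      simpa using this
  · rintro ⟨h1, h2⟩
    refine ⟨(p - (j - 1)).val, ?_, ?_⟩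
    · have hlt := ZMod.val_lt (p - (j - 1))
      have e : (((p - (j - 1)).val : ℕ) : ZMod (n + 3)) = p - (j - 1) := ZMod.natCast_zmod_val _
      generalize (p - (j - 1)).val = v at *
      refine ⟨?_, by omega⟩
      by_contra hv
      obtain rfl | rfl : v = 0 ∨ v = 1 := by omega
      · apply h1; push_cast at e; linear_combination -e
      · apply h2; push_cast at e; linear_combination -e
    · rw [ZMod.natCast_zmod_val]; ring

lemma eps_V (n : ℕ) (hn : 2 ≤ n) (hne : Even n) (x : Fin n → ℝ) (hx : x ∈ webOmega n) (j : ℕ) :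
    epsN n (Vmap n j x) = -(1 / 2) * ((Kc n x j ^ (n + 2) *
      (∏ t ∈ Finset.univ.erase (j : ZMod (n + 3)), muc n x j t) ^ 2)⁻¹ *
        Esum (n - 2) (Finset.univ.erase (j : ZMod (n + 3))) (br n x)) := by
  have hK := Kc_ne n x hx j
  set J : ZMod (n + 3) := (j : ZMod (n + 3)) with hJ
  set φ : ℕ → ZMod (n + 3) := fun t => J - 1 + (t : ZMod (n + 3)) with hφ
  have hinj : Set.InjOn φ (Finset.Icc 2 (n + 2)) := by
    intro a ha c hc h
    simp only [Finset.coe_Icc, Set.mem_Icc] at ha hc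
    by_contra hne
    exact zne n (J - 1) a c (by omega) (by omega) hne h
  have hX := Xext_V n x hx j
  have hno : ∀ t ∈ Finset.Icc 2 (n + 2), φ t ≠ J - 1 := by
    intro t ht
    rw [Finset.mem_Icc] at ht
    have := zne n (J - 1) t 0 (by omega) (by omega) (by omega)
    rw [Nat.cast_zero, add_zero] at this
    exact this
  have hXinj : Set.InjOn (Xext n (Vmap n j x)) (Finset.Icc 2 (n + 2)) := by
    intro a ha c hc h
    rw [hX a ha, hX c hc] at h
    by_contra hne
    exact cr_inj n x hx J (φ a) (φ c) (hno a ha) (hno c hc) (fun h => hne (hinj ha hc h)) h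
  rw [eps_eq n hn hne _ hXinj]
  congr 1
  rw [← Esum_scale n hn hne (ZMod.card _) (UX n x) (UY n) (br n x) (fun s t => rfl)
    (br_ne n x hx) J (Kc n x J) (muc n x J) hK (fun t _ => muc_ne n x hx J t)]
  rw [← Esum_inf _ _ _ (J - 1) (Finset.mem_erase.2 ⟨Ne.symm (jne n J).2.2.2.1, Finset.mem_univ _⟩)]
  · rw [← img_phi, Esum_image _ _ _ hinj]
    apply Esum_congr
    intro a ha c hc
    rw [hX a ha, hX c hc]
    have := cr_sub n x hx J (φ a) (φ c) (hno a ha) (hno c hc)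
    rw [show cr n x J (J - 1 + (a : ZMod (n + 3))) = cr n x J (φ a) from rfl,
      show cr n x J (J - 1 + (c : ZMod (n + 3))) = cr n x J (φ c) from rfl, this]
    simp only [muc]
    rw [if_neg (hno a ha), if_neg (hno c hc)]
    rfl
  · intro i _ hi
    have := br_ne n x hx _ _ hi
    simp only [muc]
    rw [if_neg hi, if_true]
    field_simp
  · intro i _ hi
    have := br_ne n x hx _ _ hi
    simp only [muc]
    rw [if_neg hi, if_true, show br n x (J - 1) i = - br n x i (J - 1) by unfold br; ring]
    field_simp
  · have : br n x (J - 1) (J - 1) = 0 := by unfold br; ring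
    simp [this]

/-- Velocity of the first homogeneous coordinate. -/
noncomputable def Lc (n : ℕ) (w : Fin n → ℝ) (t : ZMod (n + 3)) : ℝ :=
  if h : t.val < n then w ⟨t.val, h⟩ else 0

lemma UX_line (n : ℕ) (x w : Fin n → ℝ) (t : ZMod (n + 3)) (s : ℝ) :
    UX n (x + s • w) t = UX n x t + s * Lc n w t := by
  unfold UX Lc
  split_ifs <;> simp

lemma br_line (n : ℕ) (x w : Fin n → ℝ) (p q : ZMod (n + 3)) :
    HasDerivAt (fun s : ℝ => br n (x + s • w) p q)
      (Lc n w p * UY n q - Lc n w q * UY n p) 0 := by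
  have h1 : ∀ t, HasDerivAt (fun s : ℝ => UX n (x + s • w) t) (Lc n w t) 0 := by
    intro t
    simp_rw [UX_line]
    simpa using ((hasDerivAt_id (0 : ℝ)).mul_const (Lc n w t)).const_add (UX n x t)
  exact ((h1 p).mul_const _).sub ((h1 q).mul_const _)

lemma UX_diff (n : ℕ) (x : Fin n → ℝ) (t : ZMod (n + 3)) :
    DifferentiableAt ℝ (fun y => UX n y t) x := by
  unfold UX
  split_ifs <;> fun_prop

lemma br_diff (n : ℕ) (x : Fin n → ℝ) (p q : ZMod (n + 3)) :
    DifferentiableAt ℝ (fun y => br n y p q) x :=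
  ((UX_diff n x p).mul_const _).sub ((UX_diff n x q).mul_const _)

lemma cr_fderiv (n : ℕ) (x : Fin n → ℝ) (hx : x ∈ webOmega n) (J p : ZMod (n + 3))
    (hp : p ≠ J - 1) (w : Fin n → ℝ) :
    fderiv ℝ (fun y => cr n y J p) x w =
      (Kc n x J * (1 / br n x p (J - 1)) ^ 2) * (Lc n w p * UY n p -
        (br n x p (J - 2) * br n x p (J - 1) / (br n x (J - 3) (J - 2) * br n x (J - 3) (J - 1)) *
          (Lc n w (J - 3) * UY n (J - 3)) +
        br n x p (J - 3) * br n x p (J - 1) / (br n x (J - 2) (J - 3) * br n x (J - 2) (J - 1)) *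
          (Lc n w (J - 2) * UY n (J - 2)) +
        br n x p (J - 3) * br n x p (J - 2) / (br n x (J - 1) (J - 3) * br n x (J - 1) (J - 2)) *
          (Lc n w (J - 1) * UY n (J - 1)))) := by
  obtain ⟨a1, a2, a3, a4, a5, a6⟩ := jne n J
  have b1 := br_ne n x hx _ _ a1
  have b2 := br_ne n x hx _ _ a2
  have b3 := br_ne n x hx _ _ a3
  have b4 := br_ne n x hx _ _ hp
  have hdiff : DifferentiableAt ℝ (fun y => cr n y J p) x := by
    have hnum : DifferentiableAt ℝ (fun y => br n y p (J - 3) * br n y (J - 2) (J - 1)) x :=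
      (br_diff n x p (J - 3)).mul (br_diff n x (J - 2) (J - 1))
    have hden : DifferentiableAt ℝ (fun y => br n y p (J - 1) * br n y (J - 2) (J - 3)) x :=
      (br_diff n x p (J - 1)).mul (br_diff n x (J - 2) (J - 3))
    unfold cr
    simp_rw [div_eq_mul_inv]
    exact hnum.mul (hden.inv (mul_ne_zero b4 b1))
  have h1 := hdiff.hasFDerivAt.hasLineDerivAt w
  have h2 : HasDerivAt (fun s : ℝ => cr n (x + s • w) J p) _ 0 :=
    ((br_line n x w p (J - 3)).mul (br_line n x w (J - 2) (J - 1))).div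
      ((br_line n x w p (J - 1)).mul (br_line n x w (J - 2) (J - 3)))
      (by simpa using mul_ne_zero b4 b1)
  rw [HasDerivAt.unique h1 h2]
  simp only [zero_smul, add_zero, Pi.mul_apply]
  unfold Kc
  rw [show br n x (J - 3) (J - 2) = - br n x (J - 2) (J - 3) by unfold br; ring,
    show br n x (J - 1) (J - 3) = - br n x (J - 3) (J - 1) by unfold br; ring,
    show br n x (J - 1) (J - 2) = - br n x (J - 2) (J - 1) by unfold br; ring]
  field_simp
  unfold br
  ring

lemma webOmega_open (n : ℕ) : IsOpen (webOmega n) := by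
  have h : webOmega n = (⋂ i, {x : Fin n → ℝ | x i ≠ 0} ∩ {x | x i ≠ 1}) ∩
      ⋂ i, ⋂ j, {x : Fin n → ℝ | i ≠ j → x i ≠ x j} := by
    ext x; simp [webOmega]
  rw [h]
  refine IsOpen.inter ?_ ?_
  · refine isOpen_iInter_of_finite fun i => IsOpen.inter ?_ ?_
    · exact isOpen_ne_fun (continuous_apply i) continuous_const
    · exact isOpen_ne_fun (continuous_apply i) continuous_const
  · refine isOpen_iInter_of_finite fun i => isOpen_iInter_of_finite fun j => ?_
    by_cases hij : i = j
    · simp [hij]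
    · simp only [ne_eq, hij, not_false_eq_true, forall_const]
      exact isOpen_ne_fun (continuous_apply i) (continuous_apply j)

lemma V_fderiv (n : ℕ) (x : Fin n → ℝ) (hx : x ∈ webOmega n) (j : ℕ) (a : Fin (n - 1)) :
    fderiv ℝ (fun y => Vmap n j y a) x =
      fderiv ℝ (fun y => cr n y j (j + ((a + 1 : ℕ) : ZMod (n + 3)))) x := by
  apply Filter.EventuallyEq.fderiv_eq
  filter_upwards [(webOmega_open n).mem_nhds hx] with y hy
  unfold Vmap
  rw [cyc_iter n y hy]

/-- Index type of rows and columns. -/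
abbrev II (n : ℕ) : Type := (Fin (n - 1) ⊕ Fin 3) ⊕ Unit

/-- Position of a row. -/
def natIdx (n : ℕ) : II n → ℕ
  | Sum.inl (Sum.inl a) => a + 1
  | Sum.inl (Sum.inr s) => n + s
  | Sum.inr _ => 0

lemma natIdx_lt (n : ℕ) (r : II n) : natIdx n r < n + 3 := by
  rcases r with (a | s) | u
  · have := a.isLt; simp only [natIdx]; omega
  · have := s.isLt; simp only [natIdx]; omega
  · simp [natIdx]

lemma natIdx_inj (n : ℕ) (hn : 2 ≤ n) : Function.Injective (natIdx n) := by
  rintro ((a | s) | u) ((a' | s') | u') h <;> simp only [natIdx] at h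
  · congr 2; exact Fin.ext (by omega)
  · have := a.isLt; omega
  · omega
  · have := a'.isLt; omega
  · congr 2; exact Fin.ext (by omega)
  · omega
  · omega
  · omega
  · rfl

/-- Rows are the points. -/
noncomputable def eIdx (n : ℕ) (hn : 2 ≤ n) : II n ≃ ZMod (n + 3) :=
  Equiv.ofBijective (fun r => (natIdx n r : ZMod (n + 3))) (by
    rw [Fintype.bijective_iff_injective_and_card]
    constructor
    · intro r r' h
      by_contra hne
      exact cast_ne n _ _ (natIdx_lt n r) (natIdx_lt n r')
        (fun h => hne (natIdx_inj n hn h)) h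
    · rw [ZMod.card]
      simp
      omega)

lemma eIdx_apply (n : ℕ) (hn : 2 ≤ n) (r : II n) :
    eIdx n hn r = (natIdx n r : ZMod (n + 3)) := rfl

/-- The monomials of degree two in the homogeneous coordinates. -/
noncomputable def quad (n : ℕ) (x : Fin n → ℝ) (t : ZMod (n + 3)) : Fin 3 → ℝ :=
  ![UX n x t ^ 2, UX n x t * UY n t, UY n t ^ 2]

/-- Rows of the big matrix. -/
noncomputable def bigRow (n : ℕ) (x : Fin n → ℝ) (w : Fin (n - 1) → Fin n → ℝ)
    (q : ZMod (n + 3) → ℝ) (t : ZMod (n + 3)) : II n → ℝ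
  | Sum.inl (Sum.inl b) => Lc n (w b) t * UY n t
  | Sum.inl (Sum.inr s) => quad n x t s
  | Sum.inr _ => q t

/-- The big determinant. -/
noncomputable def bigDet (n : ℕ) (x : Fin n → ℝ) (w : Fin (n - 1) → Fin n → ℝ)
    (q : ZMod (n + 3) → ℝ) (J : ZMod (n + 3)) : ℝ :=
  (Matrix.of fun r c : II n => bigRow n x w q (J + natIdx n r) c).det

lemma sign_addLeft (n : ℕ) (hne : Even n) (J : ZMod (n + 3)) :
    Equiv.Perm.sign (Equiv.addLeft J) = 1 := by
  have h1 : (Equiv.addLeft J) ^ (n + 3) = 1 := by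
    have hk : ∀ k : ℕ, (Equiv.addLeft J) ^ k = Equiv.addLeft (k • J) := by
      intro k
      induction k with
      | zero => ext t; simp
      | succ k ih =>
        rw [pow_succ, ih]
        ext t
        simp [add_mul, add_assoc]
    rw [hk]
    have : (n + 3) • J = 0 := by
      rw [nsmul_eq_mul, ZMod.natCast_self, zero_mul]
    rw [this]; simp
  have h2 := congrArg Equiv.Perm.sign h1
  rw [map_pow, map_one] at h2
  have hodd : Odd (n + 3) := hne.add_odd (by decide)
  rcases Int.units_eq_one_or (Equiv.Perm.sign (Equiv.addLeft J)) with h | h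
  · exact h
  · rw [h, hodd.neg_one_pow] at h2
    exact absurd h2 (by decide)

lemma bigDet_shift (n : ℕ) (hn : 2 ≤ n) (hne : Even n) (x : Fin n → ℝ)
    (w : Fin (n - 1) → Fin n → ℝ) (q : ZMod (n + 3) → ℝ) (J : ZMod (n + 3)) :
    bigDet n x w q J = bigDet n x w q 0 := by
  unfold bigDet
  set σ : Equiv.Perm (II n) := ((eIdx n hn).trans (Equiv.addLeft J)).trans (eIdx n hn).symm with hσ
  have hs : Equiv.Perm.sign σ = 1 := by
    rw [hσ, ← sign_addLeft n hne J]
    exact Equiv.Perm.sign_trans_trans_symm (Equiv.addLeft J) (eIdx n hn)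
  have := Matrix.det_permute σ (Matrix.of fun r c : II n => bigRow n x w q (0 + natIdx n r) c)
  rw [hs] at this
  simp only [Units.val_one, Int.cast_one, one_mul] at this
  rw [← this]
  congr 1
  ext r c
  simp only [Matrix.of_apply, Matrix.submatrix_apply, id]
  congr 1
  rw [zero_add, ← eIdx_apply n hn, ← eIdx_apply n hn, hσ]
  simp

/-- The big determinant as a linear form. -/
noncomputable def bigLin (n : ℕ) (x : Fin n → ℝ) (w : Fin (n - 1) → Fin n → ℝ) :
    (ZMod (n + 3) → ℝ) →ₗ[ℝ] ℝ :=
  (LinearMap.proj (Sum.inr ()) ∘ₗ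
    (Matrix.cramer (Matrix.of fun r c : II n => bigRow n x w 0 (0 + natIdx n r) c))) ∘ₗ
      (LinearMap.funLeft ℝ ℝ (fun r : II n => (0 + natIdx n r : ZMod (n + 3))))

lemma bigLin_apply (n : ℕ) (x : Fin n → ℝ) (w : Fin (n - 1) → Fin n → ℝ)
    (q : ZMod (n + 3) → ℝ) : bigLin n x w q = bigDet n x w q 0 := by
  unfold bigLin bigDet
  simp only [LinearMap.comp_apply, LinearMap.proj_apply, Matrix.cramer_apply]
  congr 1
  ext r c
  rcases c with (b | s) | u
  · simp [bigRow]
  · simp [bigRow]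
  · simp [bigRow, LinearMap.funLeft_apply]

lemma bigLin_quad (n : ℕ) (x : Fin n → ℝ) (w : Fin (n - 1) → Fin n → ℝ) (s : Fin 3) :
    bigLin n x w (fun t => quad n x t s) = 0 := by
  rw [bigLin_apply]
  unfold bigDet
  apply Matrix.det_zero_of_column_eq (i := Sum.inl (Sum.inr s)) (j := Sum.inr ()) (by simp)
  intro r
  rfl

lemma bigLin_br (n : ℕ) (x : Fin n → ℝ) (w : Fin (n - 1) → Fin n → ℝ) (i k : ZMod (n + 3)) :
    bigLin n x w (fun t => br n x i t * br n x k t) = 0 := by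
  have : (fun t => br n x i t * br n x k t) =
      (UY n i * UY n k) • (fun t => quad n x t 0) +
      (-(UX n x i * UY n k + UX n x k * UY n i)) • (fun t => quad n x t 1) +
      (UX n x i * UX n x k) • (fun t => quad n x t 2) := by
    ext t
    simp [quad, br]
    ring
  rw [this, map_add, map_add, map_smul, map_smul, map_smul, bigLin_quad, bigLin_quad, bigLin_quad]
  simp

lemma bigLin_E (n : ℕ) (x : Fin n → ℝ) (hx : x ∈ webOmega n) (w : Fin (n - 1) → Fin n → ℝ)
    (m : ℕ) : bigLin n x w (fun J => Esum m (Finset.univ.erase J) (br n x)) = 0 := by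
  have : (fun J => Esum m (Finset.univ.erase J) (br n x)) =
      ∑ i, ∑ k, (br n x i k ^ m * Real.log |br n x i k| /
      ∏ l, if l = i ∨ l = k then 1 else br n x i l * br n x k l) •
        (fun t => br n x i t * br n x k t) := by
    ext J
    rw [Esum_quad m (br n x) (fun s => by unfold br; ring) (br_ne n x hx) J]
    simp
  rw [this, map_sum]
  refine Finset.sum_eq_zero fun i _ => ?_
  rw [map_sum]
  refine Finset.sum_eq_zero fun k _ => ?_
  rw [map_smul, bigLin_br, smul_zero]

lemma main_term (n : ℕ) (hn : 2 ≤ n) (hne : Even n) (x : Fin n → ℝ) (hx : x ∈ webOmega n)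
    (w : Fin (n - 1) → Fin n → ℝ) (j : ℕ) :
    epsN n (Vmap n j x) * (Matrix.of fun a b : Fin (n - 1) =>
              fderiv ℝ (fun y => Vmap n j y a) x (w b)).det =
    (1 / 2) * (Esum (n - 2) (Finset.univ.erase (j : ZMod (n + 3))) (br n x) *
      bigDet n x w (fun t => if (j : ZMod (n + 3)) = t then 1 else 0) j) := by
  set J : ZMod (n + 3) := (j : ZMod (n + 3)) with hJ
  obtain ⟨a1, a2, a3, a4, a5, a6⟩ := jne n J
  have b1 := br_ne n x hx _ _ a1
  have b2 := br_ne n x hx _ _ a2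
  have b3 := br_ne n x hx _ _ a3
  -- positions
  set p : Fin (n - 1) → ZMod (n + 3) := fun a => J + ((a + 1 : ℕ) : ZMod (n + 3)) with hp
  set N : Fin 3 → ZMod (n + 3) := fun s => J + ((n + s : ℕ) : ZMod (n + 3)) with hN
  have hN0 : N 0 = J - 3 := by simp [hN, cast_n]; ring
  have hN1 : N 1 = J - 2 := by simp [hN, cast_n]; ring
  have hN2 : N 2 = J - 1 := by simp [hN, cast_n]; ring
  have hpo : ∀ a, p a ≠ J - 1 := by
    intro a
    have ha := a.isLt
    rw [← hN2]
    exact zne n J (a + 1) (n + 2) (by omega) (by omega) (by omega)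
  -- blocks
  set A : Matrix (Fin (n - 1)) (Fin (n - 1)) ℝ :=
    Matrix.of fun a b => Lc n (w b) (p a) * UY n (p a) with hA
  set B : Matrix (Fin (n - 1)) (Fin 3) ℝ := Matrix.of fun a s => quad n x (p a) s with hB
  set C : Matrix (Fin 3) (Fin (n - 1)) ℝ :=
    Matrix.of fun s b => Lc n (w b) (N s) * UY n (N s) with hC
  set D : Matrix (Fin 3) (Fin 3) ℝ := Matrix.of fun r s => quad n x (N r) s with hD
  set L : Matrix (Fin (n - 1)) (Fin 3) ℝ := Matrix.of fun a => ![
    br n x (p a) (J - 2) * br n x (p a) (J - 1) / (br n x (J - 3) (J - 2) * br n x (J - 3) (J - 1)),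
    br n x (p a) (J - 3) * br n x (p a) (J - 1) / (br n x (J - 2) (J - 3) * br n x (J - 2) (J - 1)),
    br n x (p a) (J - 3) * br n x (p a) (J - 2) / (br n x (J - 1) (J - 3) * br n x (J - 1) (J - 2))]
    with hL
  have hLD : L * D = B := by
    ext a s
    rw [Matrix.mul_apply, Fin.sum_univ_three]
    simp only [hL, hD, hB, Matrix.of_apply, hN0, hN1, hN2, Matrix.cons_val]
    rw [show br n x (J - 3) (J - 2) = - br n x (J - 2) (J - 3) by unfold br; ring,
      show br n x (J - 1) (J - 3) = - br n x (J - 3) (J - 1) by unfold br; ring,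
      show br n x (J - 1) (J - 2) = - br n x (J - 2) (J - 1) by unfold br; ring]
    field_simp
    fin_cases s <;> simp [quad, br] <;> ring
  have hdetD : D.det = - (br n x (J - 2) (J - 3) * br n x (J - 3) (J - 1) *
      br n x (J - 2) (J - 1)) := by
    rw [Matrix.det_fin_three]
    simp only [hD, Matrix.of_apply, hN0, hN1, hN2, quad, Matrix.cons_val, br]
    ring
  have hdetG : (Matrix.fromBlocks A B C D).det = (A - L * C).det * D.det := by
    have h1 : Matrix.fromBlocks 1 (-L) 0 1 * Matrix.fromBlocks A B C D =
        Matrix.fromBlocks (A - L * C) 0 C D := by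
      rw [Matrix.fromBlocks_multiply]
      simp [hLD, sub_eq_add_neg]
    have h2 := congrArg Matrix.det h1
    rw [Matrix.det_mul, Matrix.det_fromBlocks_zero₂₁, Matrix.det_fromBlocks_zero₁₂] at h2
    simpa using h2
  have hbig : bigDet n x w (fun t => if J = t then 1 else 0) J =
      (Matrix.fromBlocks A B C D).det := by
    unfold bigDet
    have : (Matrix.of fun r c : II n => bigRow n x w (fun t => if J = t then 1 else 0)
        (J + natIdx n r) c) = Matrix.fromBlocks (Matrix.fromBlocks A B C D) 0
        (Matrix.of fun _ c => bigRow n x w (fun t => if J = t then 1 else 0) J (Sum.inl c))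
        (1 : Matrix Unit Unit ℝ) := by
      ext r c
      rcases r with (a | s) | u <;> rcases c with (b | s') | u'
      · rfl
      · rfl
      · have ha := a.isLt
        have := zne n J 0 (a + 1) (by omega) (by omega) (by omega)
        rw [Nat.cast_zero, add_zero] at this
        exact if_neg this
      · rfl
      · rfl
      · have hs := s.isLt
        have := zne n J 0 (n + s) (by omega) (by omega) (by omega)
        rw [Nat.cast_zero, add_zero] at this
        exact if_neg this
      · simp [natIdx]
      · simp [natIdx]
      · simp [natIdx, bigRow]
    rw [this, Matrix.det_fromBlocks_zero₁₂]
    simp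
  have hM : (Matrix.of fun a b : Fin (n - 1) => fderiv ℝ (fun y => Vmap n j y a) x (w b)) =
      Matrix.diagonal (fun a => Kc n x J * (1 / br n x (p a) (J - 1)) ^ 2) * (A - L * C) := by
    ext a b
    rw [Matrix.diagonal_mul, Matrix.of_apply, V_fderiv n x hx, cr_fderiv n x hx _ _ (hpo a),
      Matrix.sub_apply, Matrix.mul_apply, Fin.sum_univ_three]
    simp only [hL, hC, hA, Matrix.of_apply, hN0, hN1, hN2, Matrix.cons_val]
  have hprod : ∏ t ∈ Finset.univ.erase J, muc n x J t =
      (∏ a, 1 / br n x (p a) (J - 1)) *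
        ((1 / br n x (J - 3) (J - 1)) * (1 / br n x (J - 2) (J - 1)) * (-1 / Kc n x J)) := by
    have h1 : ∏ t, muc n x J t = muc n x J J * ∏ t ∈ Finset.univ.erase J, muc n x J t :=
      (Finset.mul_prod_erase _ _ (Finset.mem_univ J)).symm
    have h2 : ∏ t, muc n x J t = ((∏ a, muc n x J (p a)) * ∏ s, muc n x J (N s)) * muc n x J J := by
      rw [← ((eIdx n hn).trans (Equiv.addLeft J)).prod_comp, Fintype.prod_sum_type,
        Fintype.prod_sum_type]
      simp [eIdx_apply, natIdx, hp, hN]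
    rw [Fin.prod_univ_three, hN0, hN1, hN2] at h2
    have h3 : ∏ a, muc n x J (p a) = ∏ a, 1 / br n x (p a) (J - 1) := by
      apply Finset.prod_congr rfl; intro a _
      unfold muc; rw [if_neg (hpo a)]
    have h4 : muc n x J (J - 3) = 1 / br n x (J - 3) (J - 1) := by
      unfold muc; rw [if_neg a3]
    have h5 : muc n x J (J - 2) = 1 / br n x (J - 2) (J - 1) := by
      unfold muc; rw [if_neg a2]
    have h6 : muc n x J (J - 1) = -1 / Kc n x J := by
      unfold muc; rw [if_pos rfl]
    rw [h3, h4, h5, h6] at h2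
    apply mul_left_cancel₀ (muc_ne n x hx J J)
    rw [← h1, h2]; ring
  have hP0 : ∏ a, 1 / br n x (p a) (J - 1) ≠ 0 :=
    Finset.prod_ne_zero_iff.2 fun a _ => one_div_ne_zero (br_ne n x hx _ _ (hpo a))
  rw [hbig, hdetG, hdetD, hM, Matrix.det_mul, Matrix.det_diagonal, eps_V n hn hne x hx j, ← hJ,
    hprod, Finset.prod_mul_distrib, Finset.prod_const, Finset.prod_pow, Finset.card_univ,
    Fintype.card_fin]
  generalize (A - L * C).det = d
  generalize Esum (n - 2) (Finset.univ.erase J) (br n x) = E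
  generalize (∏ a, 1 / br n x (p a) (J - 1)) = P at *
  have hK := Kc_ne n x hx J
  have hKe : Kc n x J * br n x (J - 2) (J - 3) = br n x (J - 2) (J - 1) * br n x (J - 3) (J - 1) := by
    unfold Kc; field_simp
  generalize Kc n x J = K at *
  generalize br n x (J - 2) (J - 3) = c1 at *
  generalize br n x (J - 2) (J - 1) = c2 at *
  generalize br n x (J - 3) (J - 1) = c3 at *
  obtain ⟨m, rfl⟩ := Nat.exists_eq_add_of_le hn
  rw [show 2 + m - 1 = m + 1 by omega]
  have hc : c1 = c2 * c3 / K := by field_simp; linear_combination hKe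
  rw [hc]
  field_simp
  ring

/-- for `n` even with `2 ≤ n ≤ 12`, the map `C` sends `Ω` into `Ω` and, for
every `x ∈ Ω` with `1 < x₁ < … < xₙ` and all vectors `w₁,…,w_{n−1} ∈ ℝⁿ`,
`Σ_{i=1}^{n+3} ε_{n−1}(Vᵢ(x))·det Mᵢ = 0`, where `Mᵢ` is the `(n−1)×(n−1)` matrix whose
`(a,b)` entry is the directional derivative at `x` of the `a`-th component of `Vᵢ` in the
direction `w_b`  (Euler's abelian relation `Eₙ` of `W_{0,n+3}` in explicit form). -/
theorem stmt12 (n : ℕ) (hn2 : 2 ≤ n) (hn12 : n ≤ 12) (hne : Even n) :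
    Set.MapsTo (cyc n) (webOmega n) (webOmega n) ∧
    ∀ x ∈ webOmega n, 1 < x ⟨0, by omega⟩ → StrictMono x →
      ∀ w : Fin (n - 1) → (Fin n → ℝ),
        ∑ j ∈ Finset.range (n + 3),
          epsN n (Vmap n j x) *
            (Matrix.of fun a b : Fin (n - 1) =>
              fderiv ℝ (fun y => Vmap n j y a) x (w b)).det = 0 := by
  refine ⟨cyc_mapsTo n, fun x hx _ _ w => ?_⟩
  rw [Finset.sum_congr rfl (fun j _ => main_term n hn2 hne x hx w j), ← Finset.mul_sum]
  have h1 := bigLin_E n x hx w (n - 2)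
  rw [LinearMap.pi_apply_eq_sum_univ] at h1
  rw [mul_eq_zero]
  right
  refine Eq.trans ?_ h1
  refine Finset.sum_nbij' (fun j => (j : ZMod (n + 3))) (fun J => J.val) ?_ ?_ ?_ ?_ ?_
  · intro j _; exact Finset.mem_univ _
  · intro J _; exact Finset.mem_range.2 (ZMod.val_lt J)
  · intro j hj; exact ZMod.val_natCast_of_lt (Finset.mem_range.1 hj)
  · intro J _; exact ZMod.natCast_zmod_val J
  · intro j _
    rw [bigDet_shift n hn2 hne, ← bigLin_apply, smul_eq_mul]
end

section
/- Let Ω ⊂ ℝ³ be the set of triples u = (u1,u2,u3) with 1 < u1 < u2 < u3, and let C̃ : Ω → Ω be the map C̃(u) = ( u3/(u3−1), u3/(u3−u1), u3/(u3−u2) ) (C̃ maps Ω into Ω). Set ẽ2(a,b) = 1/(a·b·(b−1)), and for j = 0,1,…,5 let W_j : Ω → ℝ² be the map whose two components are the first two coordinates of the j-fold iterate C̃^{∘j}. Then for every u ∈ Ω and all vectors w1, w2 ∈ ℝ³: Σ_{j=0}^{5} (−1)^j · ẽ2(W_j(u)) · ( D(W_j)_1(u)(w1)·D(W_j)_2(u)(w2)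 − D(W_j)_1(u)(w2)·D(W_j)_2(u)(w1) ) = 0, where D(W_j)_a(u)(w) denotes the directional derivative at u of the a-th component of W_j in direction w. -/
/-- The cyclic map `C̃(u) = (u₃/(u₃−1), u₃/(u₃−u₁), u₃/(u₃−u₂))` on `ℝ³`. -/
noncomputable def Ctil (u : ℝ × ℝ × ℝ) : ℝ × ℝ × ℝ :=
  (u.2.2 / (u.2.2 - 1), u.2.2 / (u.2.2 - u.1), u.2.2 / (u.2.2 - u.2.1))

/-- The chamber `Ω = {1 < u₁ < u₂ < u₃} ⊂ ℝ³` (the positive moduli space `M_{0,6}^{>0}`). -/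
def Omega13 : Set (ℝ × ℝ × ℝ) := {u | 1 < u.1 ∧ u.1 < u.2.1 ∧ u.2.1 < u.2.2}


lemma Omega13_open : IsOpen Omega13 := by
  have h1 : IsOpen {u : ℝ × ℝ × ℝ | 1 < u.1} := isOpen_lt (by fun_prop) (by fun_prop)
  have h2 : IsOpen {u : ℝ × ℝ × ℝ | u.1 < u.2.1} := isOpen_lt (by fun_prop) (by fun_prop)
  have h3 : IsOpen {u : ℝ × ℝ × ℝ | u.2.1 < u.2.2} := isOpen_lt (by fun_prop) (by fun_prop)
  exact h1.inter (h2.inter h3)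

lemma Ctil_maps : Set.MapsTo Ctil Omega13 Omega13 := by
  rintro ⟨x, y, z⟩ ⟨h1, h2, h3⟩
  simp only at h1 h2 h3
  refine ⟨?_, ?_, ?_⟩ <;> simp only [Ctil]
  · rw [lt_div_iff₀ (by linarith)]; linarith
  · apply div_lt_div_of_pos_left <;> linarith
  · apply div_lt_div_of_pos_left <;> linarith

lemma Omega13_ne {u : ℝ × ℝ × ℝ} (hu : u ∈ Omega13) :
    u.1 ≠ 0 ∧ u.2.1 ≠ 0 ∧ u.2.2 ≠ 0 ∧ u.1 - 1 ≠ 0 ∧ u.2.1 - 1 ≠ 0 ∧ u.2.2 - 1 ≠ 0 ∧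
      u.2.1 - u.1 ≠ 0 ∧ u.2.2 - u.1 ≠ 0 ∧ u.2.2 - u.2.1 ≠ 0 := by
  obtain ⟨h1, h2, h3⟩ := hu
  refine ⟨?_, ?_, ?_, ?_, ?_, ?_, ?_, ?_, ?_⟩ <;> apply ne_of_gt <;> linarith

lemma hX (u : ℝ × ℝ × ℝ) : HasFDerivAt (fun v : ℝ × ℝ × ℝ => v.1)
    (ContinuousLinearMap.fst ℝ ℝ (ℝ × ℝ)) u := hasFDerivAt_fst

lemma hY (u : ℝ × ℝ × ℝ) : HasFDerivAt (fun v : ℝ × ℝ × ℝ => v.2.1)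
    ((ContinuousLinearMap.fst ℝ ℝ ℝ).comp (ContinuousLinearMap.snd ℝ ℝ (ℝ × ℝ))) u :=
  ((ContinuousLinearMap.fst ℝ ℝ ℝ).comp (ContinuousLinearMap.snd ℝ ℝ (ℝ × ℝ))).hasFDerivAt

lemma hZ (u : ℝ × ℝ × ℝ) : HasFDerivAt (fun v : ℝ × ℝ × ℝ => v.2.2)
    ((ContinuousLinearMap.snd ℝ ℝ ℝ).comp (ContinuousLinearMap.snd ℝ ℝ (ℝ × ℝ))) u :=
  ((ContinuousLinearMap.snd ℝ ℝ ℝ).comp (ContinuousLinearMap.snd ℝ ℝ (ℝ × ℝ))).hasFDerivAt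

/-- Derivative of a quotient, applied to a vector, after replacing `f` by a closed form on `Ω`. -/
lemma fderiv_quot {f p q : ℝ × ℝ × ℝ → ℝ} {p' q' : ℝ × ℝ × ℝ →L[ℝ] ℝ} {u : ℝ × ℝ × ℝ}
    (hu : u ∈ Omega13) (h : ∀ v ∈ Omega13, f v = p v / q v)
    (hp : HasFDerivAt p p' u) (hq : HasFDerivAt q q' u) (h0 : q u ≠ 0) (w : ℝ × ℝ × ℝ) :
    fderiv ℝ f u w = (p' w * q u - p u * q' w) / (q u) ^ 2 := by
  have e : f =ᶠ[nhds u] fun v => p v / q v :=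
    Filter.eventuallyEq_of_mem (Omega13_open.mem_nhds hu) h
  rw [e.fderiv_eq]
  have hi : HasFDerivAt (fun v => (q v)⁻¹) _ u := (hasDerivAt_inv h0).comp_hasFDerivAt u hq
  have hd : HasFDerivAt (fun v => p v * (q v)⁻¹) _ u := hp.mul hi
  simp only [div_eq_mul_inv]
  rw [hd.fderiv]
  simp
  field_simp
  ring

/-- The summand of Euler's relation. -/
noncomputable def trm (f : ℝ × ℝ × ℝ → ℝ × ℝ × ℝ) (u w1 w2 : ℝ × ℝ × ℝ) : ℝ :=
  (1 / ((f u).1 * (f u).2.1 * ((f u).2.1 - 1))) *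
        (fderiv ℝ (fun v => (f v).1) u w1 * fderiv ℝ (fun v => (f v).2.1) u w2
          - fderiv ℝ (fun v => (f v).1) u w2 * fderiv ℝ (fun v => (f v).2.1) u w1)

lemma it0 (v : ℝ × ℝ × ℝ) : Ctil^[0] v = (v.1, v.2.1, v.2.2) := rfl

lemma it1 (v : ℝ × ℝ × ℝ) (hv : v ∈ Omega13) :
    Ctil^[1] v = (v.2.2/(v.2.2-1), v.2.2/(v.2.2-v.1),
      v.2.2/(v.2.2-v.2.1)) := by
  rfl

lemma it2 (v : ℝ × ℝ × ℝ) (hv : v ∈ Omega13) :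
    Ctil^[2] v = (v.2.2/v.2.1, (v.2.2-1)/(v.2.1-1),
      (v.2.2-v.1)/(v.2.1-v.1)) := by
  obtain ⟨n1, n2, n3, n4, n5, n6, n7, n8, n9⟩ := Omega13_ne hv
  rw [Function.iterate_succ_apply', it1 v hv]
  simp only [Ctil]
  have e0 : v.2.2/(v.2.2-v.2.1) - 1 = v.2.1/(v.2.2-v.2.1) := by
    field_simp
    try ring
  have e1 : v.2.2/(v.2.2-v.2.1) - v.2.2/(v.2.2-1) = v.2.2*(v.2.1-1)/((v.2.2-v.2.1)*(v.2.2-1)) := by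
    field_simp
    try ring
  have e2 : v.2.2/(v.2.2-v.2.1) - v.2.2/(v.2.2-v.1) = v.2.2*(v.2.1-v.1)/((v.2.2-v.2.1)*(v.2.2-v.1)) := by
    field_simp
    try ring
  rw [e0, e1, e2]
  refine Prod.ext ?_ (Prod.ext ?_ ?_) <;> simp only <;> field_simp

lemma it3 (v : ℝ × ℝ × ℝ) (hv : v ∈ Omega13) :
    Ctil^[3] v = ((v.2.2-v.1)/(v.2.2-v.2.1), v.2.1*(v.2.2-v.1)/(v.1*(v.2.2-v.2.1)),
      (v.2.2-v.1)*(v.2.1-1)/((v.1-1)*(v.2.2-v.2.1))) := by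
  obtain ⟨n1, n2, n3, n4, n5, n6, n7, n8, n9⟩ := Omega13_ne hv
  rw [Function.iterate_succ_apply', it2 v hv]
  simp only [Ctil]
  have e0 : (v.2.2-v.1)/(v.2.1-v.1) - 1 = (v.2.2-v.2.1)/(v.2.1-v.1) := by
    field_simp
    try ring
  have e1 : (v.2.2-v.1)/(v.2.1-v.1) - v.2.2/v.2.1 = v.1*(v.2.2-v.2.1)/(v.2.1*(v.2.1-v.1)) := by
    field_simp
    try ring
  have e2 : (v.2.2-v.1)/(v.2.1-v.1) - (v.2.2-1)/(v.2.1-1) = (v.2.2-v.2.1)*(v.1-1)/((v.2.1-v.1)*(v.2.1-1)) := by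
    field_simp
    try ring
  rw [e0, e1, e2]
  refine Prod.ext ?_ (Prod.ext ?_ ?_) <;> simp only <;> field_simp

lemma it4 (v : ℝ × ℝ × ℝ) (hv : v ∈ Omega13) :
    Ctil^[4] v = ((v.2.2-v.1)*(v.2.1-1)/((v.2.2-1)*(v.2.1-v.1)), (v.2.1-1)/(v.2.1-v.1),
      v.1*(v.2.1-1)/(v.2.1-v.1)) := by
  obtain ⟨n1, n2, n3, n4, n5, n6, n7, n8, n9⟩ := Omega13_ne hv
  rw [Function.iterate_succ_apply', it3 v hv]
  simp only [Ctil]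
  have e0 : (v.2.2-v.1)*(v.2.1-1)/((v.1-1)*(v.2.2-v.2.1)) - 1 = (v.2.2-1)*(v.2.1-v.1)/((v.1-1)*(v.2.2-v.2.1)) := by
    field_simp
    try ring
  have e1 : (v.2.2-v.1)*(v.2.1-1)/((v.1-1)*(v.2.2-v.2.1)) - (v.2.2-v.1)/(v.2.2-v.2.1) = (v.2.2-v.1)*(v.2.1-v.1)/((v.2.2-v.2.1)*(v.1-1)) := by
    field_simp
    try ring
  have e2 : (v.2.2-v.1)*(v.2.1-1)/((v.1-1)*(v.2.2-v.2.1)) - v.2.1*(v.2.2-v.1)/(v.1*(v.2.2-v.2.1)) = (v.2.2-v.1)*(v.2.1-v.1)/((v.2.2-v.2.1)*(v.1*(v.1-1))) := by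
    field_simp
    try ring
  rw [e0, e1, e2]
  refine Prod.ext ?_ (Prod.ext ?_ ?_) <;> simp only <;> field_simp

lemma it5 (v : ℝ × ℝ × ℝ) (hv : v ∈ Omega13) :
    Ctil^[5] v = (v.1*(v.2.1-1)/(v.2.1*(v.1-1)), v.1*(v.2.2-1)/(v.2.2*(v.1-1)),
      v.1/(v.1-1)) := by
  obtain ⟨n1, n2, n3, n4, n5, n6, n7, n8, n9⟩ := Omega13_ne hv
  rw [Function.iterate_succ_apply', it4 v hv]
  simp only [Ctil]
  have e0 : v.1*(v.2.1-1)/(v.2.1-v.1) - 1 = v.2.1*(v.1-1)/(v.2.1-v.1) := by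
    field_simp
    try ring
  have e1 : v.1*(v.2.1-1)/(v.2.1-v.1) - (v.2.2-v.1)*(v.2.1-1)/((v.2.2-1)*(v.2.1-v.1)) = (v.2.1-1)*(v.2.2*(v.1-1))/((v.2.1-v.1)*(v.2.2-1)) := by
    field_simp
    try ring
  have e2 : v.1*(v.2.1-1)/(v.2.1-v.1) - (v.2.1-1)/(v.2.1-v.1) = (v.2.1-1)*(v.1-1)/(v.2.1-v.1) := by
    field_simp
    try ring
  rw [e0, e1, e2]
  refine Prod.ext ?_ (Prod.ext ?_ ?_) <;> simp only <;> field_simp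

lemma trm0 (u w1 w2 : ℝ × ℝ × ℝ) (hv : u ∈ Omega13) : trm Ctil^[0] u w1 w2 =
    ((w1.1)/(u.1)) * ((w2.2.1)/(u.2.1-1) - (w2.2.1)/(u.2.1))
    - ((w2.1)/(u.1)) * ((w1.2.1)/(u.2.1-1) - (w1.2.1)/(u.2.1)) := by
  obtain ⟨n1, n2, n3, n4, n5, n6, n7, n8, n9⟩ := Omega13_ne hv
  have hA := fderiv_quot (f := fun v => (Ctil^[0] v).1) (p := fun v => v.1)
    (q := fun v => 1) hv (fun v hv => by rw [it0 v]; simp)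
    (hX u) (hasFDerivAt_const (1:ℝ) u)
    (by simp [sub_ne_zero] at *; try tauto)
  have hB := fderiv_quot (f := fun v => (Ctil^[0] v).2.1) (p := fun v => v.2.1)
    (q := fun v => 1) hv (fun v hv => by rw [it0 v]; simp)
    (hY u) (hasFDerivAt_const (1:ℝ) u)
    (by simp [sub_ne_zero] at *; try tauto)
  have e : u.2.1 - 1 = u.2.1-1 := by
    field_simp
    try ring
  rw [trm, hA, hA, hB, hB, it0 u]
  simp only [e]
  simp
  field_simp
  try ring

lemma trm1 (u w1 w2 : ℝ × ℝ × ℝ) (hv : u ∈ Omega13) : trm Ctil^[1] u w1 w2 =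
    ((w1.2.2)/(u.2.2) - (w1.2.2)/(u.2.2-1)) * ((w2.1)/(u.1) - (w2.2.2)/(u.2.2))
    - ((w2.2.2)/(u.2.2) - (w2.2.2)/(u.2.2-1)) * ((w1.1)/(u.1) - (w1.2.2)/(u.2.2)) := by
  obtain ⟨n1, n2, n3, n4, n5, n6, n7, n8, n9⟩ := Omega13_ne hv
  have hA := fderiv_quot (f := fun v => (Ctil^[1] v).1) (p := fun v => v.2.2)
    (q := fun v => (v.2.2-1)) hv (fun v hv => by rw [it1 v hv])
    (hZ u) ((hZ u).sub_const 1)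
    (by simp [sub_ne_zero] at *; try tauto)
  have hB := fderiv_quot (f := fun v => (Ctil^[1] v).2.1) (p := fun v => v.2.2)
    (q := fun v => (v.2.2-v.1)) hv (fun v hv => by rw [it1 v hv])
    (hZ u) ((hZ u).sub (hX u))
    (by simp [sub_ne_zero] at *; try tauto)
  have e : u.2.2/(u.2.2-u.1) - 1 = u.1/(u.2.2-u.1) := by
    field_simp
    try ring
  rw [trm, hA, hA, hB, hB, it1 u hv]
  simp only [e]
  simp
  field_simp
  try ring

lemma trm2 (u w1 w2 : ℝ × ℝ × ℝ) (hv : u ∈ Omega13) : trm Ctil^[2] u w1 w2 =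
    ((w1.2.2)/(u.2.2) - (w1.2.1)/(u.2.1)) * ((w2.2.2-w2.2.1)/(u.2.2-u.2.1) - (w2.2.2)/(u.2.2-1))
    - ((w2.2.2)/(u.2.2) - (w2.2.1)/(u.2.1)) * ((w1.2.2-w1.2.1)/(u.2.2-u.2.1) - (w1.2.2)/(u.2.2-1)) := by
  obtain ⟨n1, n2, n3, n4, n5, n6, n7, n8, n9⟩ := Omega13_ne hv
  have hA := fderiv_quot (f := fun v => (Ctil^[2] v).1) (p := fun v => v.2.2)
    (q := fun v => v.2.1) hv (fun v hv => by rw [it2 v hv])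
    (hZ u) (hY u)
    (by simp [sub_ne_zero] at *; try tauto)
  have hB := fderiv_quot (f := fun v => (Ctil^[2] v).2.1) (p := fun v => (v.2.2-1))
    (q := fun v => (v.2.1-1)) hv (fun v hv => by rw [it2 v hv])
    ((hZ u).sub_const 1) ((hY u).sub_const 1)
    (by simp [sub_ne_zero] at *; try tauto)
  have e : (u.2.2-1)/(u.2.1-1) - 1 = (u.2.2-u.2.1)/(u.2.1-1) := by
    field_simp
    try ring
  rw [trm, hA, hA, hB, hB, it2 u hv]
  simp only [e]
  simp
  field_simp
  try ring

lemma trm3 (u w1 w2 : ℝ × ℝ × ℝ) (hv : u ∈ Omega13) : trm Ctil^[3] u w1 w2 =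
    ((w1.2.2-w1.1)/(u.2.2-u.1) - (w1.2.2-w1.2.1)/(u.2.2-u.2.1)) * ((w2.2.2)/(u.2.2) + (w2.2.1-w2.1)/(u.2.1-u.1) - (w2.2.1)/(u.2.1) - (w2.2.2-w2.1)/(u.2.2-u.1))
    - ((w2.2.2-w2.1)/(u.2.2-u.1) - (w2.2.2-w2.2.1)/(u.2.2-u.2.1)) * ((w1.2.2)/(u.2.2) + (w1.2.1-w1.1)/(u.2.1-u.1) - (w1.2.1)/(u.2.1) - (w1.2.2-w1.1)/(u.2.2-u.1)) := by
  obtain ⟨n1, n2, n3, n4, n5, n6, n7, n8, n9⟩ := Omega13_ne hv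
  have hA := fderiv_quot (f := fun v => (Ctil^[3] v).1) (p := fun v => (v.2.2-v.1))
    (q := fun v => (v.2.2-v.2.1)) hv (fun v hv => by rw [it3 v hv])
    ((hZ u).sub (hX u)) ((hZ u).sub (hY u))
    (by simp [sub_ne_zero] at *; try tauto)
  have hB := fderiv_quot (f := fun v => (Ctil^[3] v).2.1) (p := fun v => v.2.1*(v.2.2-v.1))
    (q := fun v => (v.1*(v.2.2-v.2.1))) hv (fun v hv => by rw [it3 v hv])
    ((hY u).mul ((hZ u).sub (hX u))) ((hX u).mul ((hZ u).sub (hY u)))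
    (by simp [sub_ne_zero] at *; try tauto)
  have e : u.2.1*(u.2.2-u.1)/(u.1*(u.2.2-u.2.1)) - 1 = u.2.2*(u.2.1-u.1)/(u.1*(u.2.2-u.2.1)) := by
    field_simp
    try ring
  rw [trm, hA, hA, hB, hB, it3 u hv]
  simp only [e]
  simp
  field_simp
  try ring

lemma trm4 (u w1 w2 : ℝ × ℝ × ℝ) (hv : u ∈ Omega13) : trm Ctil^[4] u w1 w2 =
    ((w1.2.2-w1.1)/(u.2.2-u.1) + (w1.2.1)/(u.2.1-1) - (w1.2.2)/(u.2.2-1) - (w1.2.1-w1.1)/(u.2.1-u.1)) * ((w2.1)/(u.1-1) - (w2.2.1)/(u.2.1-1))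
    - ((w2.2.2-w2.1)/(u.2.2-u.1) + (w2.2.1)/(u.2.1-1) - (w2.2.2)/(u.2.2-1) - (w2.2.1-w2.1)/(u.2.1-u.1)) * ((w1.1)/(u.1-1) - (w1.2.1)/(u.2.1-1)) := by
  obtain ⟨n1, n2, n3, n4, n5, n6, n7, n8, n9⟩ := Omega13_ne hv
  have hA := fderiv_quot (f := fun v => (Ctil^[4] v).1) (p := fun v => (v.2.2-v.1)*(v.2.1-1))
    (q := fun v => ((v.2.2-1)*(v.2.1-v.1))) hv (fun v hv => by rw [it4 v hv])
    (((hZ u).sub (hX u)).mul ((hY u).sub_const 1)) (((hZ u).sub_const 1).mul ((hY u).sub (hX u)))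
    (by simp [sub_ne_zero] at *; try tauto)
  have hB := fderiv_quot (f := fun v => (Ctil^[4] v).2.1) (p := fun v => (v.2.1-1))
    (q := fun v => (v.2.1-v.1)) hv (fun v hv => by rw [it4 v hv])
    ((hY u).sub_const 1) ((hY u).sub (hX u))
    (by simp [sub_ne_zero] at *; try tauto)
  have e : (u.2.1-1)/(u.2.1-u.1) - 1 = (u.1-1)/(u.2.1-u.1) := by
    field_simp
    try ring
  rw [trm, hA, hA, hB, hB, it4 u hv]
  simp only [e]
  simp
  field_simp
  try ring

lemma trm5 (u w1 w2 : ℝ × ℝ × ℝ) (hv : u ∈ Omega13) : trm Ctil^[5] u w1 w2 =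
    ((w1.1)/(u.1) + (w1.2.1)/(u.2.1-1) - (w1.2.1)/(u.2.1) - (w1.1)/(u.1-1)) * ((w2.2.2-w2.1)/(u.2.2-u.1) - (w2.1)/(u.1) - (w2.2.2)/(u.2.2-1))
    - ((w2.1)/(u.1) + (w2.2.1)/(u.2.1-1) - (w2.2.1)/(u.2.1) - (w2.1)/(u.1-1)) * ((w1.2.2-w1.1)/(u.2.2-u.1) - (w1.1)/(u.1) - (w1.2.2)/(u.2.2-1)) := by
  obtain ⟨n1, n2, n3, n4, n5, n6, n7, n8, n9⟩ := Omega13_ne hv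
  have hA := fderiv_quot (f := fun v => (Ctil^[5] v).1) (p := fun v => v.1*(v.2.1-1))
    (q := fun v => (v.2.1*(v.1-1))) hv (fun v hv => by rw [it5 v hv])
    ((hX u).mul ((hY u).sub_const 1)) ((hY u).mul ((hX u).sub_const 1))
    (by simp [sub_ne_zero] at *; try tauto)
  have hB := fderiv_quot (f := fun v => (Ctil^[5] v).2.1) (p := fun v => v.1*(v.2.2-1))
    (q := fun v => (v.2.2*(v.1-1))) hv (fun v hv => by rw [it5 v hv])
    ((hX u).mul ((hZ u).sub_const 1)) ((hZ u).mul ((hX u).sub_const 1))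
    (by simp [sub_ne_zero] at *; try tauto)
  have e : u.1*(u.2.2-1)/(u.2.2*(u.1-1)) - 1 = (u.2.2-u.1)/(u.2.2*(u.1-1)) := by
    field_simp
    try ring
  rw [trm, hA, hA, hB, hB, it5 u hv]
  simp only [e]
  simp
  field_simp
  try ring

/-- `C̃` maps `Ω` into `Ω`, and with `ẽ₂(a,b) = 1/(a·b·(b−1))` and `W_j` the
first two coordinates of the `j`-fold iterate of `C̃`, for every `u ∈ Ω` and all
`w₁, w₂ ∈ ℝ³` one has `Σ_{j=0}^{5} (−1)^j·ẽ₂(W_j(u))·(D(W_j)₁(u)(w₁)·D(W_j)₂(u)(w₂) −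
D(W_j)₁(u)(w₂)·D(W_j)₂(u)(w₁)) = 0`  (Euler's abelian relation `E₃` of `W_{0,6}`). -/
theorem stmt13 :
    Set.MapsTo Ctil Omega13 Omega13 ∧
    ∀ u ∈ Omega13, ∀ w1 w2 : ℝ × ℝ × ℝ,
      ∑ j ∈ Finset.range 6, (-1 : ℝ) ^ j *
        (1 / ((Ctil^[j] u).1 * (Ctil^[j] u).2.1 * ((Ctil^[j] u).2.1 - 1))) *
        (fderiv ℝ (fun v => (Ctil^[j] v).1) u w1 * fderiv ℝ (fun v => (Ctil^[j] v).2.1) u w2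
          - fderiv ℝ (fun v => (Ctil^[j] v).1) u w2 *
              fderiv ℝ (fun v => (Ctil^[j] v).2.1) u w1) = 0 := by
  refine ⟨Ctil_maps, fun u hv w1 w2 => ?_⟩
  have key : ∀ j : ℕ, (-1 : ℝ) ^ j *
        (1 / ((Ctil^[j] u).1 * (Ctil^[j] u).2.1 * ((Ctil^[j] u).2.1 - 1))) *
        (fderiv ℝ (fun v => (Ctil^[j] v).1) u w1 * fderiv ℝ (fun v => (Ctil^[j] v).2.1) u w2
          - fderiv ℝ (fun v => (Ctil^[j] v).1) u w2 *
              fderiv ℝ (fun v => (Ctil^[j] v).2.1) u w1) = (-1) ^ j * trm Ctil^[j] u w1 w2 :=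
    fun j => by rw [trm, mul_assoc]
  simp only [key]
  simp only [Finset.sum_range_succ, Finset.sum_range_zero]
  rw [trm0 u w1 w2 hv, trm1 u w1 w2 hv, trm2 u w1 w2 hv, trm3 u w1 w2 hv, trm4 u w1 w2 hv,
    trm5 u w1 w2 hv]
  clear key
  obtain ⟨n1, n2, n3, n4, n5, n6, n7, n8, n9⟩ := Omega13_ne hv
  obtain ⟨x, y, z⟩ := u
  obtain ⟨a, b, c⟩ := w1
  obtain ⟨p, q, r⟩ := w2
  simp only at *
  clear hv
  field_simp
  ring
end
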